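/- arXiv:1601.02731 — 2 statements merged into one kernel-verified Lean document; each statement's English description precedes it below -/
import Mathlib

section
/- Let n ≥ 1 and let S = {e_{j_s} − e_{i_s}}_{s=1}^{a} ∪ {2e_{k_s}}_{s=1}^{d} ∪ {e_{m_s} + e_{l_s}}_{s=1}^{f} be a strongly orthogonal set of positive roots of type C_n (all index sets pairwise disjoint, with i_s < j_s and l_s < m_s), and let σ be the product of the reflections s_α over α ∈ S, an involution in the Weyl group W(C_n). Let P_S be the associated symmetric link pattern on vertex set {−n,…,−1,1,…,n}: each root e_j − e_i contributes the two arcs (i,j) and (−j,−i), each root 2e_k contributes the arc (−k,k), and each root e_m + e_l contributes the two arcs (−l,m) and (−m,l); its number of arcs is |S| = 2a + d + 2f. Then the length of σ, defined as the number of positive roots α of C_n with σ(α) a negative root, equals |S|² − a + b(P_S) − c(P_S) − 2·r(P_S). -/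
namespace Stmt1

noncomputable section

/-- The standard basis vector `e_i` of `ℝⁿ`. -/
def e (n : ℕ) (i : Fin n) : Fin n → ℝ := Pi.single i 1

/-- The standard inner product on `ℝⁿ`. -/
def dot (n : ℕ) (u v : Fin n → ℝ) : ℝ := ∑ t, u t * v t

/-- The reflection `s_α : v ↦ v − 2(v,α)/(α,α)·α` associated to a root `α`. -/
def reflect (n : ℕ) (α : Fin n → ℝ) (v : Fin n → ℝ) : Fin n → ℝ :=
  v - (2 * dot n v α / dot n α α) • α

/-- The positive roots of the root system of type `Cₙ`:
`e_q ± e_p` for `p < q` together with `2e_p`. -/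
def RposC (n : ℕ) : Set (Fin n → ℝ) :=
  {v | (∃ p q : Fin n, p < q ∧ (v = e n q - e n p ∨ v = e n q + e n p)) ∨
       (∃ p : Fin n, v = (2 : ℝ) • e n p)}

/-- `v` is a negative root of type `Cₙ`. -/
def isNegC (n : ℕ) (v : Fin n → ℝ) : Prop := -v ∈ RposC n

/-- Crossing number `c(P)` of a link pattern given as a list of arcs `(a, b)`,
`a < b`: the number of ordered pairs of arcs `(s, t)` with `a_t < a_s < b_t < b_s`. -/
def cstat (l : List (ℤ × ℤ)) : ℕ :=
  Set.ncard {st : Fin l.length × Fin l.length |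
    (l.get st.2).1 < (l.get st.1).1 ∧ (l.get st.1).1 < (l.get st.2).2 ∧
      (l.get st.2).2 < (l.get st.1).2}

/-- Right-arc statistic `r(P)`: the number of ordered pairs of arcs `(s, t)` with
`a_t > b_s`. -/
def rstat (l : List (ℤ × ℤ)) : ℕ :=
  Set.ncard {st : Fin l.length × Fin l.length | (l.get st.1).2 < (l.get st.2).1}

/-- Bridge statistic `b(P)` on the vertex set `{−n, …, −1, 1, …, n}`: the number of
pairs (arc, vertex `v`) such that the arc's endpoints strictly surround `v` and `v`
is not an endpoint of any arc. -/
def bstat (n : ℕ) (l : List (ℤ × ℤ)) : ℕ :=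
  Set.ncard {sv : Fin l.length × ℤ |
    sv.2 ≠ 0 ∧ -(n : ℤ) ≤ sv.2 ∧ sv.2 ≤ (n : ℤ) ∧
    (l.get sv.1).1 < sv.2 ∧ sv.2 < (l.get sv.1).2 ∧
    ∀ t : Fin l.length, sv.2 ≠ (l.get t).1 ∧ sv.2 ≠ (l.get t).2}

end

end Stmt1

namespace Stmt1

open Finset

/-- The vertices `{−n, …, −1, 1, …, n}`. -/
noncomputable def vertices (n : ℕ) : Finset ℤ := {x ∈ Icc (-(n : ℤ)) n | x ≠ 0}

/-- The inversions of `w` on the finite set `V`. -/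
def inversions (V : Finset ℤ) (w : ℤ → ℤ) : Finset (ℤ × ℤ) :=
  {pq ∈ V ×ˢ V | pq.1 < pq.2 ∧ w pq.2 < w pq.1}

theorem mem_vertices {n : ℕ} {x : ℤ} :
    x ∈ vertices n ↔ -(n : ℤ) ≤ x ∧ x ≤ n ∧ x ≠ 0 := by
  simp [vertices, and_assoc]

theorem neg_mem_vertices {n : ℕ} {x : ℤ} (hx : x ∈ vertices n) : -x ∈ vertices n := by
  rw [mem_vertices] at *
  omega

section Inversions

variable {ι : Type*} [Fintype ι]

theorem sum_eq_sum_endpoints_add (V : Finset ℤ) (a b : ι → ℤ)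
    (haV : ∀ s, a s ∈ V) (hbV : ∀ s, b s ∈ V) (ha : Function.Injective a)
    (hb : Function.Injective b) (hab : ∀ s t, a s ≠ b t) (g : ℤ → ℤ) :
    ∑ x ∈ V, g x =
      ∑ s, (g (a s) + g (b s)) + ∑ x ∈ V with ∀ t, x ≠ a t ∧ x ≠ b t, g x := by
  have hset : V = (univ.image a ∪ univ.image b) ∪ {x ∈ V | ∀ t, x ≠ a t ∧ x ≠ b t} := by
    ext x
    simp only [mem_union, mem_image, mem_univ, true_and, mem_filter]
    constructor
    · intro hx
      by_cases h1 : ∃ t, a t = x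
      · exact .inl (.inl h1)
      by_cases h2 : ∃ t, b t = x
      · exact .inl (.inr h2)
      push Not at h1 h2
      exact .inr ⟨hx, fun t => ⟨(h1 t).symm, (h2 t).symm⟩⟩
    · rintro ((⟨t, rfl⟩ | ⟨t, rfl⟩) | h)
      exacts [haV t, hbV t, h.1]
  conv_lhs => rw [hset]
  rw [sum_union, sum_union, sum_image ha.injOn, sum_image hb.injOn, sum_add_distrib]
  · rw [disjoint_left]
    simp only [mem_image, mem_univ, true_and]
    rintro _ ⟨s, rfl⟩ ⟨t, h⟩
    exact hab s t h.symm
  · rw [disjoint_left]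
    simp only [mem_union, mem_image, mem_univ, true_and, mem_filter]
    rintro _ (⟨s, rfl⟩ | ⟨s, rfl⟩) ⟨-, h⟩
    exacts [(h s).1 rfl, (h s).2 rfl]

theorem card_inversions_of_arcs (V F : Finset ℤ) (a b : ι → ℤ) (w : ℤ → ℤ)
    (hF : ∀ x, x ∈ F ↔ x ∈ V ∧ ∀ t, x ≠ a t ∧ x ≠ b t)
    (haV : ∀ s, a s ∈ V) (hbV : ∀ s, b s ∈ V) (ha : Function.Injective a)
    (hb : Function.Injective b) (hab : ∀ s t, a s ≠ b t) (hlt : ∀ s, a s < b s)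
    (hwa : ∀ s, w (a s) = b s) (hwb : ∀ s, w (b s) = a s)
    (hwf : ∀ x ∈ V, (∀ t, x ≠ a t ∧ x ≠ b t) → w x = x) :
    (#(inversions V w) : ℤ) + Fintype.card ι
        + 2 * #{st : ι × ι | a st.2 < a st.1 ∧ a st.1 < b st.2 ∧ b st.2 < b st.1}
        + 4 * #{st : ι × ι | b st.1 < a st.2} =
      2 * (Fintype.card ι : ℤ) ^ 2
        + 2 * #{sx ∈ (univ : Finset ι) ×ˢ F | a sx.1 < sx.2 ∧ sx.2 < b sx.1} := by
  classical
  let I : ℤ → ℤ → ℤ := fun p q => if p < q ∧ w q < w p then 1 else 0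
  let T : ι → ι → ℤ := fun s t =>
    I (a s) (a t) + I (a s) (b t) + I (b s) (a t) + I (b s) (b t)
  let C : ι → ι → ℤ := fun s t => if a t < a s ∧ a s < b t ∧ b t < b s then 1 else 0
  let R : ι → ι → ℤ := fun s t => if b s < a t then 1 else 0
  let B : ι → ℤ → ℤ := fun s x => if a s < x ∧ x < b s then 1 else 0
  have hsplit := sum_eq_sum_endpoints_add V a b haV hbV ha hb hab
  obtain rfl : F = ({x ∈ V | ∀ t, x ≠ a t ∧ x ≠ b t} : Finset ℤ) := by
    ext x
    rw [hF, mem_filter]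
  set F : Finset ℤ := {x ∈ V | ∀ t, x ≠ a t ∧ x ≠ b t}
  have hinv : (#(inversions V w) : ℤ) = ∑ s, ∑ t, T s t + 2 * ∑ s, ∑ x ∈ F, B s x := by
    have h0 : (#(inversions V w) : ℤ) = ∑ p ∈ V, ∑ q ∈ V, I p q := by
      rw [inversions, card_filter, sum_product]
      push_cast
      rfl
    have hFF : ∑ p ∈ F, ∑ q ∈ F, I p q = 0 := by
      refine sum_eq_zero fun p hp => sum_eq_zero fun q hq => ?_
      rw [hF] at hp hq
      simp only [I, hwf p hp.1 hp.2, hwf q hq.1 hq.2]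
      exact if_neg (by omega)
    have hend : ∀ s, ∀ x ∈ F,
        I (a s) x + I (b s) x + (I x (a s) + I x (b s)) = 2 * B s x := by
      intro s x hx
      rw [hF] at hx
      simp only [I, B, hwf x hx.1 hx.2, hwa, hwb]
      have := hlt s
      split_ifs <;> omega
    have hcross : ∑ s, ∑ x ∈ F, (I (a s) x + I (b s) x) +
        ∑ x ∈ F, ∑ s, (I x (a s) + I x (b s)) = 2 * ∑ s, ∑ x ∈ F, B s x := by
      rw [sum_comm (s := F), ← sum_add_distrib, mul_sum]
      refine sum_congr rfl fun s _ => ?_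
      rw [← sum_add_distrib, mul_sum]
      exact sum_congr rfl (hend s)
    rw [h0]
    simp_rw [hsplit (fun q => I _ q)]
    rw [hsplit (fun p => ∑ s, (I p (a s) + I p (b s)) + ∑ x ∈ F, I p x)]
    rw [← hcross]
    rw [sum_add_distrib (s := F), hFF, add_zero, ← add_assoc]
    congr 1
    rw [← sum_add_distrib]
    refine sum_congr rfl fun s _ => ?_
    simp only [T, sum_add_distrib]
    ring
  have hpair : ∀ s t, (T s t + T t s) + 2 * (C s t + C t s) + 4 * (R s t + R t s)
      = 4 - 2 * (if s = t then 1 else 0) := by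
    intro s t
    have h1 := hlt s
    have h2 := hlt t
    have h3 := hab s t
    have h4 := hab t s
    by_cases hst : s = t
    · subst hst
      simp only [T, C, R, I, hwa, hwb]
      grind
    · have h5 : a s ≠ a t := fun h => hst (ha h)
      have h6 : b s ≠ b t := fun h => hst (hb h)
      simp only [T, C, R, I, hwa, hwb, hst, if_false]
      grind
  have hsum := Finset.sum_congr (rfl : (univ : Finset ι) = univ) fun s _ =>
    Finset.sum_congr (rfl : (univ : Finset ι) = univ) fun t _ => hpair s t
  simp only [sum_add_distrib, sum_sub_distrib, ← mul_sum, sum_const, card_univ,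
    sum_ite_eq, mem_univ, if_true] at hsum
  rw [sum_comm (f := fun s t => T t s), sum_comm (f := fun s t => C t s),
    sum_comm (f := fun s t => R t s)] at hsum
  have hC : (#{st : ι × ι | a st.2 < a st.1 ∧ a st.1 < b st.2 ∧ b st.2 < b st.1} : ℤ) =
      ∑ s, ∑ t, C s t := by
    rw [card_filter, ← univ_product_univ, sum_product]
    push_cast
    rfl
  have hR : (#{st : ι × ι | b st.1 < a st.2} : ℤ) = ∑ s, ∑ t, R s t := by
    rw [card_filter, ← univ_product_univ, sum_product]
    push_cast
    rfl
  have hB : (#{sx ∈ (univ : Finset ι) ×ˢ F | a sx.1 < sx.2 ∧ sx.2 < b sx.1} : ℤ) =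
      ∑ s, ∑ x ∈ F, B s x := by
    rw [card_filter, sum_product]
    push_cast
    rfl
  rw [hinv, hC, hR, hB]
  simp only [nsmul_eq_mul] at hsum
  linarith

theorem card_sign_changes_of_arcs (V : Finset ℤ) (a b : ι → ℤ) (w : ℤ → ℤ)
    (haV : ∀ s, a s ∈ V) (hbV : ∀ s, b s ∈ V) (ha : Function.Injective a)
    (hb : Function.Injective b) (hab : ∀ s t, a s ≠ b t) (hlt : ∀ s, a s < b s)
    (hwa : ∀ s, w (a s) = b s) (hwb : ∀ s, w (b s) = a s)
    (hwf : ∀ x ∈ V, (∀ t, x ≠ a t ∧ x ≠ b t) → w x = x) :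
    (#{x ∈ V | 0 < x ∧ w x < 0} : ℤ) = ∑ s, if a s < 0 ∧ 0 < b s then 1 else 0 := by
  rw [card_filter]
  push_cast
  rw [sum_eq_sum_endpoints_add V a b haV hbV ha hb hab]
  rw [sum_eq_zero (s := filter _ _), add_zero]
  · refine sum_congr rfl fun s _ => ?_
    have := hlt s
    rw [hwa, hwb]
    split_ifs <;> omega
  · intro x hx
    rw [mem_filter] at hx
    rw [hwf x hx.1 hx.2]
    exact if_neg (by omega)

end Inversions

theorem card_inversions_of_odd (n : ℕ) (w : ℤ → ℤ)
    (hodd : ∀ x ∈ vertices n, w (-x) = -w x) :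
    #(inversions (vertices n) w) + #{x ∈ vertices n | 0 < x ∧ w x < 0} =
      2 * #{pq ∈ inversions (vertices n) w | 0 ≤ pq.1 + pq.2} := by
  set A := inversions (vertices n) w with hA
  have hmem : ∀ p q, (p, q) ∈ A ↔
      (p ∈ vertices n ∧ q ∈ vertices n) ∧ p < q ∧ w q < w p := by
    intro p q
    simp [hA, inversions]
  have hneg : ∀ p q, (p, q) ∈ A → (-q, -p) ∈ A := by
    intro p q h
    rw [hmem] at *
    refine ⟨⟨neg_mem_vertices h.1.2, neg_mem_vertices h.1.1⟩, by omega, ?_⟩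
    rw [hodd _ h.1.1, hodd _ h.1.2]
    omega
  have h1 : #{pq ∈ A | 0 ≤ pq.1 + pq.2} = #{pq ∈ A | pq.1 + pq.2 ≤ 0} := by
    refine card_bij' (fun pq _ => (-pq.2, -pq.1)) (fun pq _ => (-pq.2, -pq.1)) ?_ ?_ ?_ ?_
    · rintro ⟨p, q⟩ h
      simp only [mem_filter] at *
      exact ⟨hneg _ _ h.1, by omega⟩
    · rintro ⟨p, q⟩ h
      simp only [mem_filter] at *
      exact ⟨hneg _ _ h.1, by omega⟩
    · simp
    · simp
  have h2 : #{x ∈ vertices n | 0 < x ∧ w x < 0} =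
      #({pq ∈ A | 0 ≤ pq.1 + pq.2} ∩ {pq ∈ A | pq.1 + pq.2 ≤ 0}) := by
    refine card_bij' (fun x _ => (-x, x)) (fun pq _ => pq.2) ?_ ?_ ?_ ?_
    · intro x h
      simp only [mem_filter, mem_inter] at *
      have : (-x, x) ∈ A := by
        rw [hmem]
        refine ⟨⟨neg_mem_vertices h.1, h.1⟩, by omega, ?_⟩
        rw [hodd _ h.1]
        omega
      exact ⟨⟨this, by omega⟩, this, by omega⟩
    · rintro ⟨p, q⟩ h
      simp only [mem_filter, mem_inter, hmem] at *
      obtain rfl : p = -q := by omega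
      rw [hodd _ h.1.1.1.2] at h
      exact ⟨h.1.1.1.2, by omega, by omega⟩
    · simp
    · rintro ⟨p, q⟩ h
      simp only [mem_filter, mem_inter] at h
      simp only [Prod.mk.injEq, and_true]
      omega
  have h3 : A = {pq ∈ A | 0 ≤ pq.1 + pq.2} ∪ {pq ∈ A | pq.1 + pq.2 ≤ 0} := by
    ext pq
    simp only [mem_union, mem_filter]
    have := le_total 0 (pq.1 + pq.2)
    tauto
  have h4 := card_union_add_card_inter {pq ∈ A | 0 ≤ pq.1 + pq.2} {pq ∈ A | pq.1 + pq.2 ≤ 0}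
  rw [← h3, ← h2] at h4
  omega

/-- The vector `e_x` for a vertex `x`, with the convention `e_{−x} = −e_x`. -/
noncomputable def signedBasis (n : ℕ) (x : ℤ) : Fin n → ℝ := fun t =>
  if x = (t : ℤ) + 1 then 1 else if x = -((t : ℤ) + 1) then -1 else 0

/-- The linear functional sending `e_i` to `(i + 1) ^ r`. -/
noncomputable def powerSum (n r : ℕ) : (Fin n → ℝ) →ₗ[ℝ] ℝ :=
  ∑ t : Fin n, ((t : ℝ) + 1) ^ r • LinearMap.proj t

theorem signedBasis_succ (n : ℕ) (p : Fin n) : signedBasis n ((p : ℤ) + 1) = e n p := by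
  ext t
  simp only [signedBasis, e, Pi.single_apply, Fin.ext_iff]
  split_ifs <;> first | rfl | omega

theorem signedBasis_neg (n : ℕ) (x : ℤ) : signedBasis n (-x) = -signedBasis n x := by
  ext t
  simp only [signedBasis, Pi.neg_apply]
  split_ifs <;> first | omega | simp

theorem exists_eq_of_mem_vertices {n : ℕ} {x : ℤ} (hx : x ∈ vertices n) :
    ∃ p : Fin n, x = (p : ℤ) + 1 ∨ x = -((p : ℤ) + 1) := by
  rw [mem_vertices] at hx
  exact ⟨⟨x.natAbs - 1, by omega⟩, by simp only; omega⟩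

theorem succ_mem_vertices {n : ℕ} (p : Fin n) : (p : ℤ) + 1 ∈ vertices n := by
  rw [mem_vertices]
  omega

theorem powerSum_e (n r : ℕ) (p : Fin n) : powerSum n r (e n p) = ((p : ℝ) + 1) ^ r := by
  simp [powerSum, e, Pi.single_apply]

theorem powerSum_signedBasis {n r : ℕ} (hr : Odd r) {x : ℤ} (hx : x ∈ vertices n) :
    powerSum n r (signedBasis n x) = (x : ℝ) ^ r := by
  obtain ⟨p, rfl | rfl⟩ := exists_eq_of_mem_vertices hx
  · rw [signedBasis_succ, powerSum_e]
    push_cast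
    rfl
  · rw [signedBasis_neg, signedBasis_succ, map_neg, powerSum_e]
    push_cast
    rw [hr.neg_pow]

theorem powerSum_pos_of_mem_RposC {n : ℕ} {v : Fin n → ℝ} (hv : v ∈ RposC n) :
    0 < powerSum n 1 v := by
  rcases hv with ⟨p, q, hpq, rfl | rfl⟩ | ⟨p, rfl⟩
  · have : (p : ℝ) < q := by exact_mod_cast hpq
    simp only [map_sub, powerSum_e]
    linarith
  · simp only [map_add, powerSum_e]
    positivity
  · simp only [map_smul, powerSum_e, smul_eq_mul]
    positivity

theorem signedBasis_sub_mem_RposC {n : ℕ} {x y : ℤ} (hx : x ∈ vertices n)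
    (hy : y ∈ vertices n) : signedBasis n y - signedBasis n x ∈ RposC n ↔ x < y := by
  constructor
  · intro h
    have := powerSum_pos_of_mem_RposC h
    rw [map_sub, powerSum_signedBasis odd_one hx, powerSum_signedBasis odd_one hy] at this
    have : (x : ℝ) < y := by linarith
    exact_mod_cast this
  · intro h
    obtain ⟨p, rfl | rfl⟩ := exists_eq_of_mem_vertices hx <;>
      obtain ⟨q, rfl | rfl⟩ := exists_eq_of_mem_vertices hy <;>
      simp only [signedBasis_neg, signedBasis_succ]
    · exact .inl ⟨p, q, by omega, .inl rfl⟩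
    · omega
    · rw [sub_neg_eq_add]
      rcases lt_trichotomy p q with hpq | rfl | hpq
      · exact .inl ⟨p, q, hpq, .inr rfl⟩
      · exact .inr ⟨p, (two_smul ℝ _).symm⟩
      · exact .inl ⟨q, p, hpq, .inr (add_comm _ _)⟩
    · exact .inl ⟨q, p, by omega, .inl (by abel)⟩

theorem exists_of_mem_RposC {n : ℕ} {v : Fin n → ℝ} (hv : v ∈ RposC n) :
    ∃ x y : ℤ, x ∈ vertices n ∧ y ∈ vertices n ∧ x < y ∧ 0 ≤ x + y ∧
      v = signedBasis n y - signedBasis n x := by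
  rcases hv with ⟨p, q, hpq, rfl | rfl⟩ | ⟨p, rfl⟩
  · exact ⟨p + 1, q + 1, succ_mem_vertices p, succ_mem_vertices q, by omega, by omega, by
      simp only [signedBasis_succ]⟩
  · exact ⟨-(p + 1), q + 1, neg_mem_vertices (succ_mem_vertices p), succ_mem_vertices q,
      by omega, by omega, by simp only [signedBasis_neg, signedBasis_succ, sub_neg_eq_add]⟩
  · exact ⟨-(p + 1), p + 1, neg_mem_vertices (succ_mem_vertices p), succ_mem_vertices p,
      by omega, by omega, by
        simp only [signedBasis_neg, signedBasis_succ, sub_neg_eq_add, two_smul]⟩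

theorem signedBasis_sub_injOn (n : ℕ) :
    Set.InjOn (fun pq : ℤ × ℤ => signedBasis n pq.2 - signedBasis n pq.1)
      {pq | pq.1 ∈ vertices n ∧ pq.2 ∈ vertices n ∧ pq.1 < pq.2 ∧ 0 ≤ pq.1 + pq.2} := by
  rintro ⟨p, q⟩ ⟨hp, hq, hlt, hs⟩ ⟨p', q'⟩ ⟨hp', hq', hlt', hs'⟩ h
  simp only at *
  have h1 := congrArg (powerSum n 1) h
  have h3 := congrArg (powerSum n 3) h
  have odd3 : Odd 3 := by decide
  simp only [map_sub, powerSum_signedBasis odd_one hp, powerSum_signedBasis odd_one hq,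
    powerSum_signedBasis odd_one hp', powerSum_signedBasis odd_one hq', pow_one] at h1
  simp only [map_sub, powerSum_signedBasis odd3 hp, powerSum_signedBasis odd3 hq,
    powerSum_signedBasis odd3 hp', powerSum_signedBasis odd3 hq'] at h3
  norm_cast at h1 h3
  have hsq : (p + q) ^ 2 = (p' + q') ^ 2 := by
    have hne : (q - p) * 3 ≠ 0 := by omega
    apply mul_left_cancel₀ hne
    have e1 : (q - p) * 3 * (p + q) ^ 2 = 4 * (q ^ 3 - p ^ 3) - (q - p) ^ 3 := by ring
    have e2 : (q' - p') * 3 * (p' + q') ^ 2 = 4 * (q' ^ 3 - p' ^ 3) - (q' - p') ^ 3 := by ring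
    rw [e1, h1, e2, h3]
  have hsum : p + q = p' + q' := (pow_left_inj₀ hs hs' two_ne_zero).1 hsq
  ext <;> simp only <;> omega

theorem ncard_inverted_roots (n : ℕ) (σ : (Fin n → ℝ) →ₗ[ℝ] (Fin n → ℝ)) (w : ℤ → ℤ)
    (hw : ∀ x ∈ vertices n, w x ∈ vertices n)
    (hσ : ∀ x ∈ vertices n, σ (signedBasis n x) = signedBasis n (w x)) :
    2 * Set.ncard {α : Fin n → ℝ | α ∈ RposC n ∧ isNegC n (σ α)} =
      #(inversions (vertices n) w) + #{x ∈ vertices n | 0 < x ∧ w x < 0} := by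
  rw [card_inversions_of_odd]
  · congr 1
    rw [← Set.ncard_coe_finset]
    have himg : {α : Fin n → ℝ | α ∈ RposC n ∧ isNegC n (σ α)} =
        (fun pq : ℤ × ℤ => signedBasis n pq.2 - signedBasis n pq.1) ''
          ↑{pq ∈ inversions (vertices n) w | 0 ≤ pq.1 + pq.2} := by
      have key : ∀ x ∈ vertices n, ∀ y ∈ vertices n,
          isNegC n (σ (signedBasis n y - signedBasis n x)) ↔ w y < w x := by
        intro x hx y hy
        rw [isNegC, map_sub, hσ x hx, hσ y hy, neg_sub,
          signedBasis_sub_mem_RposC (hw y hy) (hw x hx)]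
      ext α
      simp only [Set.mem_ofPred_eq, Set.mem_image, inversions, coe_filter, mem_filter,
        mem_product, Prod.exists]
      constructor
      · rintro ⟨h1, h2⟩
        obtain ⟨x, y, hx, hy, hlt, hs, rfl⟩ := exists_of_mem_RposC h1
        exact ⟨x, y, ⟨⟨⟨hx, hy⟩, hlt, (key x hx y hy).1 h2⟩, hs⟩, rfl⟩
      · rintro ⟨x, y, ⟨⟨⟨hx, hy⟩, hlt, h2⟩, hs⟩, rfl⟩
        exact ⟨(signedBasis_sub_mem_RposC hx hy).2 hlt, (key x hx y hy).2 h2⟩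
    rw [himg]
    refine ((signedBasis_sub_injOn n).mono ?_).ncard_image
    rintro ⟨p, q⟩ h
    simp only [inversions, coe_filter, mem_filter, mem_product, Set.mem_ofPred_eq] at *
    tauto
  · intro x hx
    have h1 := hσ _ (neg_mem_vertices hx)
    rw [signedBasis_neg, map_neg, hσ x hx] at h1
    have h2 := congrArg (powerSum n 1) h1
    rw [map_neg, powerSum_signedBasis odd_one (hw x hx),
      powerSum_signedBasis odd_one (hw _ (neg_mem_vertices hx)), pow_one, pow_one] at h2
    exact_mod_cast h2.symm

theorem dot_foldr_reflect {n : ℕ} {L : List (Fin n → ℝ)} {α : Fin n → ℝ}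
    (h : ∀ β ∈ L, dot n β α = 0) (v : Fin n → ℝ) :
    dot n ((L.map (reflect n)).foldr (· ∘ ·) id v) α = dot n v α := by
  induction L with
  | nil => rfl
  | cons β L ih =>
    rw [← ih fun γ hγ => h γ (List.mem_cons_of_mem _ hγ)]
    have hβ := h β List.mem_cons_self
    simp only [dot] at hβ
    simp only [List.map_cons, List.foldr_cons, Function.comp_apply, reflect]
    simp only [dot, Pi.sub_apply, Pi.smul_apply, smul_eq_mul, sub_mul, sum_sub_distrib,
      mul_assoc, ← mul_sum, hβ, mul_zero, sub_zero]

theorem foldr_reflect_eq {n : ℕ} {L : List (Fin n → ℝ)}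
    (h : L.Pairwise fun α β => dot n β α = 0) (v : Fin n → ℝ) :
    (L.map (reflect n)).foldr (· ∘ ·) id v =
      v - (L.map fun α => (2 * dot n v α / dot n α α) • α).sum := by
  induction L with
  | nil => simp
  | cons α L ih =>
    rw [List.pairwise_cons] at h
    simp only [List.map_cons, List.foldr_cons, Function.comp_apply, List.sum_cons]
    rw [reflect, dot_foldr_reflect h.1, ih h.2]
    abel

theorem isLinearMap_reflect (n : ℕ) (α : Fin n → ℝ) : IsLinearMap ℝ (reflect n α) where
  map_add u v := by
    ext t
    simp only [reflect, dot, Pi.add_apply, Pi.sub_apply, Pi.smul_apply, smul_eq_mul, add_mul,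
      sum_add_distrib]
    ring
  map_smul c v := by
    ext t
    simp only [reflect, dot, Pi.sub_apply, Pi.smul_apply, smul_eq_mul, mul_assoc, ← mul_sum]
    ring

theorem isLinearMap_foldr_reflect (n : ℕ) (L : List (Fin n → ℝ)) :
    IsLinearMap ℝ ((L.map (reflect n)).foldr (· ∘ ·) id) := by
  induction L with
  | nil => exact LinearMap.id.isLinear
  | cons α L ih => exact ((isLinearMap_reflect n α).mk' _ ∘ₗ ih.mk' _).isLinear

theorem e_apply (n : ℕ) (p t : Fin n) : e n p t = if t = p then 1 else 0 :=
  Pi.single_apply p 1 t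

theorem dot_e_sub_e (n : ℕ) (v : Fin n → ℝ) (p q : Fin n) :
    dot n v (e n q - e n p) = v q - v p := by
  simp [dot, e_apply, mul_sub]

theorem dot_e_add_e (n : ℕ) (v : Fin n → ℝ) (p q : Fin n) :
    dot n v (e n q + e n p) = v q + v p := by
  simp [dot, e_apply, mul_add, sum_add_distrib]

theorem dot_two_smul_e (n : ℕ) (v : Fin n → ℝ) (p : Fin n) :
    dot n v ((2 : ℝ) • e n p) = 2 * v p := by
  simp [dot, e_apply, mul_comm]

theorem exists_involution_of_arcs {ι : Type*} (a b : ι → ℤ) (ha : Function.Injective a)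
    (hb : Function.Injective b) (hab : ∀ s t, a s ≠ b t) :
    ∃ w : ℤ → ℤ, (∀ s, w (a s) = b s) ∧ (∀ s, w (b s) = a s) ∧
      ∀ x, (∀ t, x ≠ a t ∧ x ≠ b t) → w x = x := by
  classical
  refine ⟨fun x => if h : ∃ s, a s = x then b h.choose else
    if h : ∃ s, b s = x then a h.choose else x, fun s => ?_, fun s => ?_, fun x hx => ?_⟩
  · have h : ∃ t, a t = a s := ⟨s, rfl⟩
    simp only [dif_pos h]
    exact congrArg b (ha h.choose_spec)
  · have h : ∃ t, b t = b s := ⟨s, rfl⟩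
    have h' : ¬ ∃ t, a t = b s := fun ⟨t, ht⟩ => hab t s ht
    simp only [dif_neg h', dif_pos h]
    exact congrArg a (hb h.choose_spec)
  · have h : ¬ ∃ t, b t = x := fun ⟨t, ht⟩ => (hx t).2 ht.symm
    have h' : ¬ ∃ t, a t = x := fun ⟨t, ht⟩ => (hx t).1 ht.symm
    simp only [dif_neg h', dif_neg h]

theorem length_of_arcs (n : ℕ) (σ : (Fin n → ℝ) → Fin n → ℝ) (hlin : IsLinearMap ℝ σ)
    (arcs : List (ℤ × ℤ))
    (hfst : (arcs.map Prod.fst).Nodup) (hsnd : (arcs.map Prod.snd).Nodup)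
    (hne : ∀ x ∈ arcs, ∀ y ∈ arcs, x.1 ≠ y.2) (hlt : ∀ x ∈ arcs, x.1 < x.2)
    (hV : ∀ x ∈ arcs, x.1 ∈ vertices n ∧ x.2 ∈ vertices n)
    (hσ : ∀ x ∈ arcs, σ (signedBasis n x.1) = signedBasis n x.2 ∧
      σ (signedBasis n x.2) = signedBasis n x.1)
    (hfix : ∀ x ∈ vertices n, (∀ y ∈ arcs, x ≠ y.1 ∧ x ≠ y.2) →
      σ (signedBasis n x) = signedBasis n x) :
    2 * (Set.ncard {α : Fin n → ℝ | α ∈ RposC n ∧ isNegC n (σ α)} : ℤ) =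
      2 * (arcs.length : ℤ) ^ 2 - arcs.length
        + (arcs.map fun x => if x.1 < 0 ∧ 0 < x.2 then (1 : ℤ) else 0).sum
        + 2 * (bstat n arcs : ℤ) - 2 * (cstat arcs : ℤ) - 4 * (rstat arcs : ℤ) := by
  let a : Fin arcs.length → ℤ := fun s => (arcs.get s).1
  let b : Fin arcs.length → ℤ := fun s => (arcs.get s).2
  have hmem : ∀ s, arcs.get s ∈ arcs := fun s => List.get_mem arcs s
  have ha : Function.Injective a := by
    intro s t h
    have := (hfst.getElem_inj_iff (i := s) (j := t) (hi := by simp) (hj := by simp)).1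
      (by simpa [a] using h)
    exact Fin.ext this
  have hb : Function.Injective b := by
    intro s t h
    have := (hsnd.getElem_inj_iff (i := s) (j := t) (hi := by simp) (hj := by simp)).1
      (by simpa [b] using h)
    exact Fin.ext this
  have hab : ∀ s t, a s ≠ b t := fun s t => hne _ (hmem s) _ (hmem t)
  have hlt' : ∀ s, a s < b s := fun s => hlt _ (hmem s)
  have haV : ∀ s, a s ∈ vertices n := fun s => (hV _ (hmem s)).1
  have hbV : ∀ s, b s ∈ vertices n := fun s => (hV _ (hmem s)).2
  obtain ⟨w, hwa, hwb, hwf⟩ := exists_involution_of_arcs a b ha hb hab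
  have hcases : ∀ x, (∃ s, x = a s) ∨ (∃ s, x = b s) ∨ ∀ t, x ≠ a t ∧ x ≠ b t := by
    intro x
    by_cases h1 : ∃ s, x = a s
    · exact .inl h1
    by_cases h2 : ∃ s, x = b s
    · exact .inr (.inl h2)
    push Not at h1 h2
    exact .inr (.inr fun t => ⟨h1 t, h2 t⟩)
  have hroots := ncard_inverted_roots n (hlin.mk' σ) w
    (by
      intro x hx
      obtain ⟨s, rfl⟩ | ⟨s, rfl⟩ | h := hcases x
      · rw [hwa]; exact hbV s
      · rw [hwb]; exact haV s
      · rwa [hwf x h])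
    (by
      intro x hx
      rw [IsLinearMap.mk'_apply]
      obtain ⟨s, rfl⟩ | ⟨s, rfl⟩ | h := hcases x
      · rw [hwa]; exact (hσ _ (hmem s)).1
      · rw [hwb]; exact (hσ _ (hmem s)).2
      · rw [hwf x h]
        refine hfix x hx fun y hy => ?_
        obtain ⟨s, rfl⟩ := List.get_of_mem hy
        exact h s)
  have hinv := card_inversions_of_arcs (vertices n)
    {x ∈ vertices n | ∀ t, x ≠ a t ∧ x ≠ b t} a b w (fun _ => mem_filter) haV hbV ha hb hab hlt' hwa hwb
    fun x _ => hwf x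
  have hsign := card_sign_changes_of_arcs (vertices n) a b w haV hbV ha hb hab hlt' hwa hwb
    fun x _ => hwf x
  have hC : cstat arcs = #{st : Fin arcs.length × Fin arcs.length |
      a st.2 < a st.1 ∧ a st.1 < b st.2 ∧ b st.2 < b st.1} := by
    rw [cstat, ← Set.ncard_coe_finset]
    simp [a, b]
  have hR : rstat arcs = #{st : Fin arcs.length × Fin arcs.length | b st.1 < a st.2} := by
    rw [rstat, ← Set.ncard_coe_finset]
    simp [a, b]
  have hB : bstat n arcs = #{sx ∈ (univ : Finset (Fin arcs.length)) ×ˢ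
      {x ∈ vertices n | ∀ t, x ≠ a t ∧ x ≠ b t} | a sx.1 < sx.2 ∧ sx.2 < b sx.1} := by
    rw [bstat, ← Set.ncard_coe_finset]
    congr 1
    ext ⟨s, x⟩
    simp only [Set.mem_ofPred_eq, coe_filter, mem_product, mem_filter, mem_univ, true_and,
      mem_vertices, a, b]
    tauto
  have hS : (arcs.map fun x => if x.1 < 0 ∧ 0 < x.2 then (1 : ℤ) else 0).sum =
      ∑ s, if a s < 0 ∧ 0 < b s then 1 else 0 := by
    rw [← Fin.sum_univ_fun_getElem]
    rfl
  have hroots' : 2 * (Set.ncard {α : Fin n → ℝ | α ∈ RposC n ∧ isNegC n (σ α)} : ℤ) =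
      #(inversions (vertices n) w) + #{x ∈ vertices n | 0 < x ∧ w x < 0} := by
    exact_mod_cast hroots
  rw [hroots', hS, hC, hR, hB, ← hsign]
  rw [Fintype.card_fin] at hinv
  linarith

theorem arcs_nodup {a d f : ℕ} (I J : Fin a → ℤ) (K : Fin d → ℤ) (L M : Fin f → ℤ)
    (h : (List.ofFn I ++ List.ofFn J ++ List.ofFn K ++ List.ofFn L ++ List.ofFn M).Nodup)
    (hI : ∀ s, 0 < I s) (hJ : ∀ s, 0 < J s) (hK : ∀ s, 0 < K s) (hL : ∀ s, 0 < L s)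
    (hM : ∀ s, 0 < M s) (arcs : List (ℤ × ℤ))
    (harcs : arcs = (List.ofFn fun s => (I s, J s)) ++ (List.ofFn fun s => (-J s, -I s)) ++
      (List.ofFn fun s => (-K s, K s)) ++ (List.ofFn fun s => (-M s, L s)) ++
      (List.ofFn fun s => (-L s, M s))) :
    (arcs.map Prod.fst).Nodup ∧ (arcs.map Prod.snd).Nodup ∧
      ∀ x ∈ arcs, ∀ y ∈ arcs, x.1 ≠ y.2 := by
  subst harcs
  simp only [List.nodup_append, List.nodup_ofFn, List.mem_append, List.mem_ofFn,
    List.map_append, List.map_ofFn, Function.comp_def, Function.Injective] at *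
  obtain ⟨⟨⟨⟨hi, hj, hIJ⟩, hk, hIJK⟩, hl, hIJKL⟩, hm, hIJKLM⟩ := h
  refine ⟨⟨⟨⟨⟨?_, ?_, ?_⟩, ?_, ?_⟩, ?_, ?_⟩, ?_, ?_⟩,
    ⟨⟨⟨⟨?_, ?_, ?_⟩, ?_, ?_⟩, ?_, ?_⟩, ?_, ?_⟩, ?_⟩ <;> grind

set_option linter.unusedSimpArgs false in
theorem foldr_reflect_apply_e {n a d f : ℕ} (i j : Fin a → Fin n) (k : Fin d → Fin n)
    (l m : Fin f → Fin n)
    (hdisj : (List.ofFn i ++ List.ofFn j ++ List.ofFn k ++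
              List.ofFn l ++ List.ofFn m).Nodup)
    (σ : (Fin n → ℝ) → Fin n → ℝ)
    (hσ : σ = (((List.ofFn fun s => e n (j s) - e n (i s)) ++
                (List.ofFn fun s => (2 : ℝ) • e n (k s)) ++
                (List.ofFn fun s => e n (m s) + e n (l s))).map
                  (reflect n)).foldr (· ∘ ·) id) :
    (∀ s, σ (e n (i s)) = e n (j s)) ∧ (∀ s, σ (e n (j s)) = e n (i s)) ∧
      (∀ s, σ (e n (k s)) = -e n (k s)) ∧ (∀ s, σ (e n (l s)) = -e n (m s)) ∧
      (∀ s, σ (e n (m s)) = -e n (l s)) ∧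
      ∀ p, ((∀ s, i s ≠ p) ∧ (∀ s, j s ≠ p) ∧ (∀ s, k s ≠ p) ∧ (∀ s, l s ≠ p) ∧
        ∀ s, m s ≠ p) → σ (e n p) = e n p := by
  simp only [List.nodup_append, List.nodup_ofFn, List.mem_append, List.mem_ofFn] at hdisj
  obtain ⟨⟨⟨⟨hi, hj, hIJ⟩, hk, hIJK⟩, hl, hIJKL⟩, hm, hIJKLM⟩ := hdisj
  have ij : ∀ s t, i s ≠ j t := fun s t => hIJ _ ⟨s, rfl⟩ _ ⟨t, rfl⟩
  have ik : ∀ s t, i s ≠ k t := fun s t => hIJK _ (.inl ⟨s, rfl⟩) _ ⟨t, rfl⟩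
  have jk : ∀ s t, j s ≠ k t := fun s t => hIJK _ (.inr ⟨s, rfl⟩) _ ⟨t, rfl⟩
  have il : ∀ s t, i s ≠ l t := fun s t => hIJKL _ (.inl (.inl ⟨s, rfl⟩)) _ ⟨t, rfl⟩
  have jl : ∀ s t, j s ≠ l t := fun s t => hIJKL _ (.inl (.inr ⟨s, rfl⟩)) _ ⟨t, rfl⟩
  have kl : ∀ s t, k s ≠ l t := fun s t => hIJKL _ (.inr ⟨s, rfl⟩) _ ⟨t, rfl⟩
  have im : ∀ s t, i s ≠ m t := fun s t => hIJKLM _ (.inl (.inl (.inl ⟨s, rfl⟩))) _ ⟨t, rfl⟩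
  have jm : ∀ s t, j s ≠ m t := fun s t => hIJKLM _ (.inl (.inl (.inr ⟨s, rfl⟩))) _ ⟨t, rfl⟩
  have km : ∀ s t, k s ≠ m t := fun s t => hIJKLM _ (.inl (.inr ⟨s, rfl⟩)) _ ⟨t, rfl⟩
  have lm : ∀ s t, l s ≠ m t := fun s t => hIJKLM _ (.inr ⟨s, rfl⟩) _ ⟨t, rfl⟩
  have ji := fun s t => (ij t s).symm
  have ki := fun s t => (ik t s).symm
  have kj := fun s t => (jk t s).symm
  have li := fun s t => (il t s).symm
  have lj := fun s t => (jl t s).symm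
  have lk := fun s t => (kl t s).symm
  have mi := fun s t => (im t s).symm
  have mj := fun s t => (jm t s).symm
  have mk := fun s t => (km t s).symm
  have ml := fun s t => (lm t s).symm
  have hformula : ∀ v t, σ v t = v t
      - ∑ s, (v (j s) - v (i s)) * (e n (j s) t - e n (i s) t)
      - ∑ s, v (k s) * (2 * e n (k s) t)
      - ∑ s, (v (m s) + v (l s)) * (e n (m s) t + e n (l s) t) := by
    intro v t
    rw [hσ, foldr_reflect_eq]
    · simp only [List.map_append, List.sum_append, List.map_ofFn, List.sum_ofFn,
        Function.comp_def, dot_e_sub_e, dot_e_add_e, dot_two_smul_e, Pi.sub_apply, Pi.add_apply,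
        Finset.sum_apply, Pi.smul_apply, smul_eq_mul]
      simp only [e_apply, if_true, ij, ji, lm, ml, if_false]
      rw [sub_add_eq_sub_sub, sub_add_eq_sub_sub]
      congr 1
      · congr 1
        · congr 1
          exact Finset.sum_congr rfl fun s _ => by ring
        · exact Finset.sum_congr rfl fun s _ => by ring
      · exact Finset.sum_congr rfl fun s _ => by ring
    · simp only [List.pairwise_append, List.pairwise_ofFn, List.mem_append, List.mem_ofFn]
      refine ⟨⟨?_, ?_, ?_⟩, ?_, ?_⟩
      · intro s t hst
        simp [dot_e_sub_e, e_apply, ij, ji, hi.eq_iff, hj.eq_iff, hst.ne, hst.ne']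
      · intro s t hst
        simp [dot_two_smul_e, e_apply, hk.eq_iff, hst.ne, hst.ne']
      · rintro _ ⟨s, rfl⟩ _ ⟨t, rfl⟩
        simp [dot_e_sub_e, e_apply, ki, kj, ik, jk]
      · intro s t hst
        simp [dot_e_add_e, e_apply, lm, ml, hl.eq_iff, hm.eq_iff, hst.ne, hst.ne']
      · rintro _ (⟨s, rfl⟩ | ⟨s, rfl⟩) _ ⟨t, rfl⟩
        · simp [dot_e_sub_e, e_apply, il, jl, im, jm, li, lj, mi, mj]
        · simp [dot_two_smul_e, e_apply, kl, lk, km, mk]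
  have σi : ∀ s, σ (e n (i s)) = e n (j s) := by
    intro s
    ext t
    rw [hformula]
    simp [e_apply, ij, ik, il, im, jk, jl, jm, kl, km, lm, ji, ki, kj, li, lj,
      lk, mi, mj, mk, ml, hi.eq_iff, hj.eq_iff, hk.eq_iff, hl.eq_iff, hm.eq_iff]
  have σj : ∀ s, σ (e n (j s)) = e n (i s) := by
    intro s
    ext t
    rw [hformula]
    simp [e_apply, ij, ik, il, im, jk, jl, jm, kl, km, lm, ji, ki, kj, li, lj,
      lk, mi, mj, mk, ml, hi.eq_iff, hj.eq_iff, hk.eq_iff, hl.eq_iff, hm.eq_iff]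
  have σk : ∀ s, σ (e n (k s)) = -e n (k s) := by
    intro s
    ext t
    rw [hformula]
    simp [e_apply, ij, ik, il, im, jk, jl, jm, kl, km, lm, ji, ki, kj, li, lj,
      lk, mi, mj, mk, ml, hi.eq_iff, hj.eq_iff, hk.eq_iff, hl.eq_iff, hm.eq_iff]
    rw [Finset.sum_eq_single s (fun b _ hb => by simp [hb]) (by simp)]
    simp only [if_true]
    split_ifs <;> norm_num
  have σl : ∀ s, σ (e n (l s)) = -e n (m s) := by
    intro s
    ext t
    rw [hformula]
    simp [e_apply, ij, ik, il, im, jk, jl, jm, kl, km, lm, ji, ki, kj, li, lj,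
      lk, mi, mj, mk, ml, hi.eq_iff, hj.eq_iff, hk.eq_iff, hl.eq_iff, hm.eq_iff]
  have σm : ∀ s, σ (e n (m s)) = -e n (l s) := by
    intro s
    ext t
    rw [hformula]
    simp [e_apply, ij, ik, il, im, jk, jl, jm, kl, km, lm, ji, ki, kj, li, lj,
      lk, mi, mj, mk, ml, hi.eq_iff, hj.eq_iff, hk.eq_iff, hl.eq_iff, hm.eq_iff]
  refine ⟨σi, σj, σk, σl, σm, fun p h => ?_⟩
  ext t
  rw [hformula]
  obtain ⟨pi, pj, pk, pl, pm⟩ := h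
  simp [e_apply, pi, pj, pk, pl, pm]

end Stmt1

open Stmt1 in
/-- Let `S = {e_{jₛ} − e_{iₛ}} ∪ {2e_{kₛ}} ∪ {e_{mₛ} + e_{lₛ}}`
(`a`, `d` and `f` roots of each kind) be a strongly orthogonal set of positive roots
of type `Cₙ` (all index sets pairwise disjoint, `iₛ < jₛ`, `lₛ < mₛ`), let `σ` be
the product of the reflections `s_α`, `α ∈ S`, and let `arcs` be the associated
symmetric link pattern on `{−n, …, −1, 1, …, n}` (a `Fin n`-index `x` is the vertex
`x + 1`).  Then the length of `σ` — the number of positive roots of `Cₙ` sent by `σ`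
to negative roots — equals `|S|² − a + b(P_S) − c(P_S) − 2·r(P_S)`, where
`|S| = arcs.length = 2a + d + 2f` is the number of arcs. -/
theorem panyushev_length_formula_Cn (n a d f : ℕ) (hn : 1 ≤ n)
    (i j : Fin a → Fin n) (k : Fin d → Fin n) (l m : Fin f → Fin n)
    (hij : ∀ s, i s < j s) (hlm : ∀ s, l s < m s)
    (hdisj : (List.ofFn i ++ List.ofFn j ++ List.ofFn k ++
              List.ofFn l ++ List.ofFn m).Nodup)
    (σ : (Fin n → ℝ) → Fin n → ℝ)
    (hσ : σ = (((List.ofFn fun s => e n (j s) - e n (i s)) ++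
                (List.ofFn fun s => (2 : ℝ) • e n (k s)) ++
                (List.ofFn fun s => e n (m s) + e n (l s))).map
                  (reflect n)).foldr (· ∘ ·) id)
    (arcs : List (ℤ × ℤ))
    (harcs : arcs =
      (List.ofFn fun s => (((i s : ℕ) : ℤ) + 1, ((j s : ℕ) : ℤ) + 1)) ++
      (List.ofFn fun s => (-(((j s : ℕ) : ℤ) + 1), -(((i s : ℕ) : ℤ) + 1))) ++
      (List.ofFn fun s => (-(((k s : ℕ) : ℤ) + 1), ((k s : ℕ) : ℤ) + 1)) ++
      (List.ofFn fun s => (-(((m s : ℕ) : ℤ) + 1), ((l s : ℕ) : ℤ) + 1)) ++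
      (List.ofFn fun s => (-(((l s : ℕ) : ℤ) + 1), ((m s : ℕ) : ℤ) + 1))) :
    (Set.ncard {α : Fin n → ℝ | α ∈ RposC n ∧ isNegC n (σ α)} : ℤ) =
      (arcs.length : ℤ) ^ 2 - (a : ℤ) + (bstat n arcs : ℤ) - (cstat arcs : ℤ)
        - 2 * (rstat arcs : ℤ) := by
  have hlin : IsLinearMap ℝ σ := hσ ▸ isLinearMap_foldr_reflect n _
  obtain ⟨σi, σj, σk, σl, σm, σp⟩ := foldr_reflect_apply_e i j k l m hdisj σ hσ
  have σneg : ∀ v, σ (-v) = -σ v := hlin.map_neg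
  have hmem : ∀ x ∈ arcs,
      (∃ s, x = ((i s : ℤ) + 1, (j s : ℤ) + 1)) ∨
      (∃ s, x = (-((j s : ℤ) + 1), -((i s : ℤ) + 1))) ∨
      (∃ s, x = (-((k s : ℤ) + 1), (k s : ℤ) + 1)) ∨
      (∃ s, x = (-((m s : ℤ) + 1), (l s : ℤ) + 1)) ∨
      (∃ s, x = (-((l s : ℤ) + 1), (m s : ℤ) + 1)) := by
    intro x hx
    rw [harcs] at hx
    simp only [List.mem_append, List.mem_ofFn, eq_comm (b := x)] at hx
    tauto
  have hlen : arcs.length = 2 * a + d + 2 * f := by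
    rw [harcs]
    simp only [List.length_append, List.length_ofFn]
    omega
  obtain ⟨hfst, hsnd, hne⟩ := arcs_nodup (fun s => ((i s : ℕ) : ℤ) + 1)
    (fun s => ((j s : ℕ) : ℤ) + 1) (fun s => ((k s : ℕ) : ℤ) + 1)
    (fun s => ((l s : ℕ) : ℤ) + 1) (fun s => ((m s : ℕ) : ℤ) + 1)
    (by
      have := hdisj.map (f := fun p : Fin n => ((p : ℕ) : ℤ) + 1)
        fun p q h => Fin.ext (by simpa using h)
      simpa only [List.map_append, List.map_ofFn, Function.comp_def] using this)
    (fun _ => by omega) (fun _ => by omega) (fun _ => by omega) (fun _ => by omega)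
    (fun _ => by omega) arcs harcs
  have hmain := length_of_arcs n σ hlin arcs hfst hsnd hne
    (by
      intro x hx
      obtain ⟨s, rfl⟩ | ⟨s, rfl⟩ | ⟨s, rfl⟩ | ⟨s, rfl⟩ | ⟨s, rfl⟩ := hmem x hx <;> simp only
      · have := hij s; omega
      · have := hij s; omega
      all_goals omega)
    (by
      intro x hx
      obtain ⟨s, rfl⟩ | ⟨s, rfl⟩ | ⟨s, rfl⟩ | ⟨s, rfl⟩ | ⟨s, rfl⟩ := hmem x hx <;>
        simp only [mem_vertices] <;> omega)
    (by
      intro x hx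
      obtain ⟨s, rfl⟩ | ⟨s, rfl⟩ | ⟨s, rfl⟩ | ⟨s, rfl⟩ | ⟨s, rfl⟩ := hmem x hx <;>
        simp only [signedBasis_neg, signedBasis_succ, σneg, σi, σj, σk, σl, σm, neg_neg,
          and_self])
    (by
      intro x hx hfree
      have key : ∀ p : Fin n, (∀ y ∈ arcs, ((p : ℕ) : ℤ) + 1 ≠ y.1 ∧ ((p : ℕ) : ℤ) + 1 ≠ y.2) ∨
          (∀ y ∈ arcs, -(((p : ℕ) : ℤ) + 1) ≠ y.1 ∧ -(((p : ℕ) : ℤ) + 1) ≠ y.2) →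
          σ (e n p) = e n p := by
        intro p hp
        apply σp
        have hi : ∀ s, ((i s : ℤ) + 1, (j s : ℤ) + 1) ∈ arcs := by
          intro s
          simp only [harcs, List.mem_append, List.mem_ofFn]
          exact .inl (.inl (.inl (.inl ⟨s, rfl⟩)))
        have hj : ∀ s, (-((j s : ℤ) + 1), -((i s : ℤ) + 1)) ∈ arcs := by
          intro s
          simp only [harcs, List.mem_append, List.mem_ofFn]
          exact .inl (.inl (.inl (.inr ⟨s, rfl⟩)))
        have hk : ∀ s, (-((k s : ℤ) + 1), (k s : ℤ) + 1) ∈ arcs := by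
          intro s
          simp only [harcs, List.mem_append, List.mem_ofFn]
          exact .inl (.inl (.inr ⟨s, rfl⟩))
        have hl : ∀ s, (-((m s : ℤ) + 1), (l s : ℤ) + 1) ∈ arcs := by
          intro s
          simp only [harcs, List.mem_append, List.mem_ofFn]
          exact .inl (.inr ⟨s, rfl⟩)
        have hm : ∀ s, (-((l s : ℤ) + 1), (m s : ℤ) + 1) ∈ arcs := by
          intro s
          simp only [harcs, List.mem_append, List.mem_ofFn]
          exact .inr ⟨s, rfl⟩
        refine ⟨?_, ?_, ?_, ?_, ?_⟩ <;> rintro s rfl <;> rcases hp with hp | hp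
        · exact (hp _ (hi s)).1 rfl
        · exact (hp _ (hj s)).2 rfl
        · exact (hp _ (hi s)).2 rfl
        · exact (hp _ (hj s)).1 rfl
        · exact (hp _ (hk s)).2 rfl
        · exact (hp _ (hk s)).1 rfl
        · exact (hp _ (hl s)).2 rfl
        · exact (hp _ (hm s)).1 rfl
        · exact (hp _ (hm s)).2 rfl
        · exact (hp _ (hl s)).1 rfl
      obtain ⟨p, rfl | rfl⟩ := exists_eq_of_mem_vertices hx
      · rw [signedBasis_succ, key p (.inl hfree)]
      · rw [signedBasis_neg, signedBasis_succ, σneg, key p (.inr hfree)])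
  have hsum : (arcs.map fun x => if x.1 < 0 ∧ 0 < x.2 then (1 : ℤ) else 0).sum =
      d + 2 * f := by
    rw [harcs]
    simp only [List.map_append, List.sum_append, List.map_ofFn, List.sum_ofFn,
      Function.comp_def]
    rw [Finset.sum_eq_zero fun s _ => if_neg (by omega),
      Finset.sum_eq_zero fun s _ => if_neg (by omega),
      Finset.sum_congr rfl fun s _ => if_pos (by omega),
      Finset.sum_congr rfl fun s _ => if_pos (by omega),
      Finset.sum_congr rfl fun s _ => if_pos (by omega)]
    simp
    ring
  rw [hsum] at hmain
  have hlen' : (arcs.length : ℤ) = 2 * a + d + 2 * f := by exact_mod_cast hlen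
  linarith
end

section
/- Let n ≥ 2 and let S = {e_{j_s} − e_{i_s}}_{s=1}^{a} ∪ {e_{k_s}}_{s=1}^{2d} ∪ {e_{m_s} + e_{l_s}}_{s=1}^{f} be a set of pairwise strongly orthogonal positive roots of type B_n (all index sets pairwise disjoint, i_s < j_s, l_s < m_s), containing an even number 2d of short roots e_k, and let σ be the product of the corresponding reflections; σ is an involution lying in the Weyl group W(D_n). Let P_S be the associated symmetric link pattern on vertex set {−n,…,−1,1,…,n}: each root e_j − e_i gives arcs (i,j) and (−j,−i), each root e_k gives the arc (−k,k), each root e_m + e_l gives arcs (−l,m) and (−m,l); its number of arcs is |S| = 2a + 2d + 2f. Then the length of σ with respect to the D_n root system, i.e. #{α ∈ R⁺(D_n) : σ(α) ∈ R⁻(D_n)}, equals |S|² − |S| + a + b(P_S) − c(P_S) − 2·r(P_S). -/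
namespace Stmt2

noncomputable section

/-- The standard basis vector `e_i` of `ℝⁿ`. -/
def e (n : ℕ) (i : Fin n) : Fin n → ℝ := Pi.single i 1

/-- The standard inner product on `ℝⁿ`. -/
def dot (n : ℕ) (u v : Fin n → ℝ) : ℝ := ∑ t, u t * v t

/-- The reflection `s_α : v ↦ v − 2(v,α)/(α,α)·α` associated to a root `α`. -/
def reflect (n : ℕ) (α : Fin n → ℝ) (v : Fin n → ℝ) : Fin n → ℝ :=
  v - (2 * dot n v α / dot n α α) • α

/-- The positive roots of the root system of type `Dₙ`: `e_q ± e_p` for `p < q`. -/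
def RposD (n : ℕ) : Set (Fin n → ℝ) :=
  {v | ∃ p q : Fin n, p < q ∧ (v = e n q - e n p ∨ v = e n q + e n p)}

/-- `v` is a negative root of type `Dₙ`. -/
def isNegD (n : ℕ) (v : Fin n → ℝ) : Prop := -v ∈ RposD n

/-- Crossing number `c(P)` of a link pattern given as a list of arcs `(a, b)`,
`a < b`: the number of ordered pairs of arcs `(s, t)` with `a_t < a_s < b_t < b_s`. -/
def cstat (l : List (ℤ × ℤ)) : ℕ :=
  Set.ncard {st : Fin l.length × Fin l.length |
    (l.get st.2).1 < (l.get st.1).1 ∧ (l.get st.1).1 < (l.get st.2).2 ∧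
      (l.get st.2).2 < (l.get st.1).2}

/-- Right-arc statistic `r(P)`: the number of ordered pairs of arcs `(s, t)` with
`a_t > b_s`. -/
def rstat (l : List (ℤ × ℤ)) : ℕ :=
  Set.ncard {st : Fin l.length × Fin l.length | (l.get st.1).2 < (l.get st.2).1}

/-- Bridge statistic `b(P)` on the vertex set `{−n, …, −1, 1, …, n}`: the number of
pairs (arc, vertex `v`) such that the arc's endpoints strictly surround `v` and `v`
is not an endpoint of any arc. -/
def bstat (n : ℕ) (l : List (ℤ × ℤ)) : ℕ :=
  Set.ncard {sv : Fin l.length × ℤ |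
    sv.2 ≠ 0 ∧ -(n : ℤ) ≤ sv.2 ∧ sv.2 ≤ (n : ℤ) ∧
    (l.get sv.1).1 < sv.2 ∧ sv.2 < (l.get sv.1).2 ∧
    ∀ t : Fin l.length, sv.2 ≠ (l.get t).1 ∧ sv.2 ≠ (l.get t).2}

end

end Stmt2

namespace Stmt2

open Finset

section Involution

/-- The number of inversions of `w` on the finite set `V`. -/
def invCount (V : Finset ℤ) (w : ℤ → ℤ) : ℕ :=
  ∑ u ∈ V, ∑ v ∈ V, if u < v ∧ w v < w u then 1 else 0

theorem ncard_setOf_prod {ι κ : Type*} [Fintype ι] (T : Finset κ) (p : ι → κ → Prop)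
    [∀ s t, Decidable (p s t)] :
    Set.ncard {st : ι × κ | st.2 ∈ T ∧ p st.1 st.2} = ∑ s, ∑ t ∈ T, if p s t then 1 else 0 := by
  have h : {st : ι × κ | st.2 ∈ T ∧ p st.1 st.2} =
      ((univ ×ˢ T).filter fun st : ι × κ => p st.1 st.2 : Finset (ι × κ)) := by
    ext st; simp
  rw [h, Set.ncard_coe_finset, card_filter, sum_product]

theorem card_filter_get {α : Type*} (L : List α) (p : α → Prop) [DecidablePred p] :
    #(univ.filter fun s => p (L.get s)) = L.countP fun a => decide (p a) := by
  induction L with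
  | nil => simp
  | cons a L ih =>
    rw [List.countP_cons, ← ih]
    refine (Fin.card_filter_univ_succ fun s => p ((a :: L).get s)).trans ?_
    simp only [List.get_cons_zero, List.get_cons_succ', decide_eq_true_eq]
    split_ifs <;> rfl

/-- The contribution of an ordered pair of arcs to the inversions of the involution. -/
theorem arc_pair_identity {x₁ y₁ x₂ y₂ : ℤ} (h₁ : x₁ < y₁) (h₂ : x₂ < y₂)
    (h : (x₁ = x₂ ∧ y₁ = y₂) ∨ (x₁ ≠ x₂ ∧ y₁ ≠ y₂)) (hxy : x₁ ≠ y₂) (hyx : y₁ ≠ x₂) :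
    ((if x₁ < x₂ ∧ y₂ < y₁ then 1 else 0) + (if x₁ < y₂ ∧ x₂ < y₁ then 1 else 0) +
      ((if y₁ < x₂ ∧ y₂ < x₁ then 1 else 0) + (if y₁ < y₂ ∧ x₂ < x₁ then 1 else 0)) : ℕ) +
      ((if x₂ < x₁ ∧ x₁ < y₂ ∧ y₂ < y₁ then 1 else 0) +
        (if x₁ < x₂ ∧ x₂ < y₁ ∧ y₁ < y₂ then 1 else 0)) +
      2 * ((if y₁ < x₂ then 1 else 0) + (if y₂ < x₁ then 1 else 0)) +
      (if x₁ = x₂ then 1 else 0) = 2 := by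
  grind

/-- Sums over a vertex set split into the endpoints of arcs and the remaining vertices. -/
theorem sum_vertices {N : ℕ} (x y : Fin N → ℤ) (V : Finset ℤ)
    (hx : Function.Injective x) (hy : Function.Injective y) (hxy : ∀ s t, x s ≠ y t)
    (hxV : ∀ s, x s ∈ V) (hyV : ∀ s, y s ∈ V) (g : ℤ → ℕ) :
    ∑ u ∈ V, g u = ∑ s, (g (x s) + g (y s)) +
      ∑ u ∈ V.filter (fun u => ∀ t, u ≠ x t ∧ u ≠ y t), g u := by
  have h : V = (univ.image x ∪ univ.image y) ∪ V.filter (fun u => ∀ t, u ≠ x t ∧ u ≠ y t) := by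
    ext u
    simp only [mem_union, mem_image, mem_univ, true_and, mem_filter]
    constructor
    · intro hu
      by_cases h1 : ∃ a, x a = u
      · exact Or.inl (Or.inl h1)
      by_cases h2 : ∃ a, y a = u
      · exact Or.inl (Or.inr h2)
      push Not at h1 h2
      exact Or.inr ⟨hu, fun t => ⟨(h1 t).symm, (h2 t).symm⟩⟩
    · rintro ((⟨a, rfl⟩ | ⟨a, rfl⟩) | h)
      exacts [hxV a, hyV a, h.1]
  conv_lhs => rw [h]
  rw [sum_union, sum_union, sum_image hx.injOn, sum_image hy.injOn, sum_add_distrib]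
  · rw [disjoint_left]
    simp only [mem_image, mem_univ, true_and, not_exists]
    rintro _ ⟨a, rfl⟩ b hb
    exact hxy a b hb.symm
  · rw [disjoint_left]
    simp only [mem_union, mem_image, mem_univ, true_and, mem_filter, not_and, not_forall]
    rintro _ (⟨a, rfl⟩ | ⟨a, rfl⟩) - <;> exact ⟨a, by simp⟩

/-- The number of inversions of an involution in terms of its link pattern. -/
theorem invCount_add {N : ℕ} (x y : Fin N → ℤ) (V : Finset ℤ) (w : ℤ → ℤ)
    (hlt : ∀ s, x s < y s)
    (hx : Function.Injective x) (hy : Function.Injective y) (hxy : ∀ s t, x s ≠ y t)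
    (hxV : ∀ s, x s ∈ V) (hyV : ∀ s, y s ∈ V)
    (hwx : ∀ s, w (x s) = y s) (hwy : ∀ s, w (y s) = x s)
    (hwf : ∀ u ∈ V, (∀ t, u ≠ x t ∧ u ≠ y t) → w u = u) :
    invCount V w +
      2 * (∑ s, ∑ t, if x t < x s ∧ x s < y t ∧ y t < y s then 1 else 0) +
      4 * (∑ s, ∑ t, if y s < x t then 1 else 0) + N =
      2 * N ^ 2 + 2 * (∑ s, ∑ v ∈ V.filter (fun u => ∀ t, u ≠ x t ∧ u ≠ y t),
        if x s < v ∧ v < y s then 1 else 0) := by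
  set F := V.filter (fun u => ∀ t, u ≠ x t ∧ u ≠ y t) with hF
  have hwF : ∀ u ∈ F, w u = u := fun u hu => by
    rw [hF, mem_filter] at hu; exact hwf u hu.1 hu.2
  have hsplit : ∀ g : ℤ → ℕ, ∑ u ∈ V, g u = ∑ s, (g (x s) + g (y s)) + ∑ u ∈ F, g u :=
    sum_vertices x y V hx hy hxy hxV hyV
  have hpair (s t : Fin N) := arc_pair_identity (hlt s) (hlt t)
    (by
      by_cases h : s = t
      · subst h; simp
      · exact Or.inr ⟨fun h' => h (hx h'), fun h' => h (hy h')⟩) (hxy s t)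
    (fun h => hxy t s h.symm)
  have key := sum_congr (rfl : (univ : Finset (Fin N)) = univ) fun s _ =>
    sum_congr (rfl : (univ : Finset (Fin N)) = univ) fun t _ => hpair s t
  have h2 : ∑ _s : Fin N, ∑ _t : Fin N, 2 = 2 * N ^ 2 := by simp [sq]; ring
  rw [h2] at key
  simp only [sum_add_distrib, ← mul_sum] at key
  have hδ : ∑ s, ∑ t, (if x s = x t then 1 else 0) = N := by simp [hx.eq_iff]
  rw [hδ] at key
  rw [sum_comm (f := fun s t => if x s < x t ∧ x t < y s ∧ y s < y t then 1 else 0),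
    sum_comm (f := fun s t => if y t < x s then 1 else 0)] at key
  have hEF : ∀ s, (∑ v ∈ F, if x s < v ∧ w v < w (x s) then 1 else 0) =
      ∑ v ∈ F, if x s < v ∧ v < y s then 1 else 0 := fun s =>
    sum_congr rfl fun v hv => by rw [hwF v hv, hwx]
  have hEF' : ∀ s, (∑ v ∈ F, if y s < v ∧ w v < w (y s) then 1 else 0) = 0 := fun s =>
    sum_eq_zero fun v hv => by
      rw [hwF v hv, hwy, if_neg]; have := hlt s; omega
  have hFE : (∑ u ∈ F, ∑ s, if u < x s ∧ w (x s) < w u then 1 else 0) = 0 :=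
    sum_eq_zero fun v hv => sum_eq_zero fun s _ => by
      rw [hwF v hv, hwx, if_neg]; have := hlt s; omega
  have hFE' : (∑ u ∈ F, ∑ s, if u < y s ∧ w (y s) < w u then 1 else 0) =
      ∑ s, ∑ v ∈ F, if x s < v ∧ v < y s then 1 else 0 := by
    rw [sum_comm]
    refine sum_congr rfl fun s _ => sum_congr rfl fun v hv => ?_
    simp only [hwF v hv, hwy, and_comm]
  have hFF : (∑ u ∈ F, ∑ v ∈ F, if u < v ∧ w v < w u then 1 else 0) = 0 :=
    sum_eq_zero fun u hu => sum_eq_zero fun v hv => by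
      rw [hwF v hv, hwF u hu, if_neg]; omega
  simp only [invCount, hsplit, sum_add_distrib, hEF, hEF', hFE, hFE', hFF, sum_const_zero]
  simp only [hwx, hwy]
  omega

/-- The inversions of an odd map on a symmetric vertex set, counted through the
representatives `(u, v)` with `-v < u < v`, and the sign changes. -/
theorem invCount_odd (n : ℕ) (w : ℤ → ℤ) (V : Finset ℤ)
    (hV : V = (Icc (-(n : ℤ)) n).erase 0)
    (hodd : ∀ z ∈ V, w (-z) = -w z) :
    invCount V w = 2 * #((V ×ˢ V).filter fun p : ℤ × ℤ => -p.2 < p.1 ∧ p.1 < p.2 ∧ w p.2 < w p.1) +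
      #(V.filter fun v => v < 0 ∧ 0 < w v) := by
  have hneg : ∀ z, z ∈ V ↔ -z ∈ V := fun z => by
    simp only [hV, mem_erase, mem_Icc]; omega
  rw [invCount, ← sum_product', ← card_filter]
  set T := (V ×ˢ V).filter fun p : ℤ × ℤ => -p.2 < p.1 ∧ p.1 < p.2 ∧ w p.2 < w p.1 with hT
  set Z := V.filter fun v => v < 0 ∧ 0 < w v with hZ
  have h : ((V ×ˢ V).filter fun p : ℤ × ℤ => p.1 < p.2 ∧ w p.2 < w p.1) =
      (T ∪ T.image fun p => (-p.2, -p.1)) ∪ Z.image fun v => (v, -v) := by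
    ext ⟨u, v⟩
    simp only [hT, hZ, mem_union, mem_filter, mem_product, mem_image, Prod.mk.injEq, Prod.exists]
    constructor
    · rintro ⟨⟨hu, hv⟩, h1, h2⟩
      rcases lt_trichotomy (-v) u with h | h | h
      · exact Or.inl (Or.inl ⟨⟨hu, hv⟩, h, h1, h2⟩)
      · refine Or.inr ⟨u, ⟨hu, ?_⟩, rfl, by omega⟩
        have := hodd u hu
        rw [show -u = v by omega] at this
        omega
      · refine Or.inl (Or.inr ⟨-v, -u, ⟨⟨(hneg v).1 hv, (hneg u).1 hu⟩, ?_⟩, by simp, by simp⟩)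
        rw [hodd u hu, hodd v hv]
        omega
    · rintro ((h | ⟨a, b, ⟨⟨ha, hb⟩, h⟩, rfl, rfl⟩) | ⟨a, ⟨ha, h⟩, rfl, rfl⟩)
      · exact ⟨h.1, h.2.2⟩
      · refine ⟨⟨(hneg b).1 hb, (hneg a).1 ha⟩, ?_⟩
        rw [hodd a ha, hodd b hb]
        omega
      · refine ⟨⟨ha, (hneg a).1 ha⟩, ?_⟩
        rw [hodd a ha]
        omega
  rw [h, card_union_of_disjoint, card_union_of_disjoint, card_image_of_injective,
    card_image_of_injective, two_mul]
  · intro a b h; simpa using h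
  · rintro ⟨a, b⟩ ⟨c, d⟩ h; simp at h; simp [h]
  · rw [disjoint_left]
    rintro ⟨u, v⟩ h1 h2
    simp only [hT, mem_filter, mem_image, Prod.mk.injEq, Prod.exists] at h1 h2
    obtain ⟨a, b, h, rfl, rfl⟩ := h2
    omega
  · rw [disjoint_left]
    rintro ⟨u, v⟩ h1 h2
    simp only [hT, mem_union, mem_filter, mem_image, Prod.mk.injEq, Prod.exists] at h1 h2
    obtain ⟨a, h, rfl, rfl⟩ := h2
    rcases h1 with h1 | ⟨b, c, h1, h3, h4⟩ <;> omega

end Involution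

section Roots

variable {n : ℕ}

/-- The vector attached to a vertex: `ev z = e_z` for `z > 0` and `ev z = -e_{-z}` for `z < 0`. -/
noncomputable def ev (n : ℕ) (z : ℤ) : Fin n → ℝ := fun t =>
  if (t : ℤ) + 1 = z then 1 else if (t : ℤ) + 1 = -z then -1 else 0

theorem ev_neg (z : ℤ) : ev n (-z) = -ev n z := by
  funext t
  simp only [ev, Pi.neg_apply]
  grind

theorem ev_succ (t : Fin n) : ev n ((t : ℕ) + 1) = e n t := by
  funext u
  have : ((u : ℕ) : ℤ) + 1 = (t : ℕ) + 1 ↔ u = t := by rw [Fin.ext_iff]; omega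
  have h2 : ¬ ((u : ℕ) : ℤ) + 1 = -((t : ℕ) + 1) := by omega
  simp only [ev, e, Pi.single_apply, this, h2, if_false]

theorem ev_neg_succ (t : Fin n) : ev n (-((t : ℕ) + 1)) = -e n t := by
  rw [ev_neg, ev_succ]

/-- The linear functional taking `ev z` to `z`. -/
noncomputable def height (n : ℕ) (v : Fin n → ℝ) : ℝ := ∑ t : Fin n, (((t : ℕ) : ℝ) + 1) * v t

theorem height_sub (u v : Fin n → ℝ) : height n (u - v) = height n u - height n v := by
  simp [height, mul_sub]

theorem height_neg (v : Fin n → ℝ) : height n (-v) = -height n v := by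
  simp [height]

theorem height_e (t : Fin n) : height n (e n t) = ((t : ℕ) : ℝ) + 1 := by
  simp [height, e, Pi.single_apply]

theorem exists_fin_succ {z : ℤ} (h0 : z ≠ 0) (h1 : -(n : ℤ) ≤ z) (h2 : z ≤ n) :
    ∃ t : Fin n, z = (t : ℕ) + 1 ∨ z = -((t : ℕ) + 1) :=
  ⟨⟨z.natAbs - 1, by omega⟩, by simp only; omega⟩

theorem height_ev {z : ℤ} (h0 : z ≠ 0) (h1 : -(n : ℤ) ≤ z) (h2 : z ≤ n) :
    height n (ev n z) = z := by
  obtain ⟨t, rfl | rfl⟩ := exists_fin_succ h0 h1 h2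
  · rw [ev_succ, height_e]; push_cast; rfl
  · rw [ev_neg_succ, height_neg, height_e]; push_cast; rfl

theorem height_pos {v : Fin n → ℝ} (hv : v ∈ RposD n) : 0 < height n v := by
  obtain ⟨p, q, hpq, rfl | rfl⟩ := hv
  · rw [height_sub, height_e, height_e]
    have : ((p : ℕ) : ℝ) < (q : ℕ) := by exact_mod_cast hpq
    linarith
  · rw [← sub_neg_eq_add, height_sub, height_neg, height_e, height_e, sub_neg_eq_add]
    positivity

theorem mem_RposD_iff (α : Fin n → ℝ) :
    α ∈ RposD n ↔ ∃ u v : ℤ, u ≠ 0 ∧ -v < u ∧ u < v ∧ v ≤ n ∧ α = ev n v - ev n u := by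
  constructor
  · rintro ⟨p, q, hpq, rfl | rfl⟩
    · refine ⟨(p : ℕ) + 1, (q : ℕ) + 1, ?_⟩
      rw [ev_succ, ev_succ]
      refine ⟨?_, ?_, ?_, ?_, rfl⟩ <;> omega
    · refine ⟨-((p : ℕ) + 1), (q : ℕ) + 1, ?_⟩
      rw [ev_succ, ev_neg_succ, sub_neg_eq_add]
      refine ⟨?_, ?_, ?_, ?_, rfl⟩ <;> omega
  · rintro ⟨u, v, hu, h1, h2, h3, rfl⟩
    obtain ⟨q, rfl | rfl⟩ := exists_fin_succ (n := n) (z := v) (by omega) (by omega) h3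
    · obtain ⟨p, rfl | rfl⟩ := exists_fin_succ (n := n) (z := u) hu (by omega) (by omega)
      · exact ⟨p, q, by omega, Or.inl (by rw [ev_succ, ev_succ])⟩
      · exact ⟨p, q, by omega, Or.inr (by rw [ev_succ, ev_neg_succ, sub_neg_eq_add])⟩
    · omega

/-- A difference of signed basis vectors is a negative root exactly when the indices are
in increasing order. -/
theorem isNegD_ev_sub {x y : ℤ} (hx : x ≠ 0) (hx1 : -(n : ℤ) ≤ x) (hx2 : x ≤ n)
    (hy : y ≠ 0) (hy1 : -(n : ℤ) ≤ y) (hy2 : y ≤ n) (hxy : x ≠ -y) :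
    isNegD n (ev n x - ev n y) ↔ x < y := by
  rw [isNegD, neg_sub]
  constructor
  · intro h
    have := height_pos h
    rw [height_sub, height_ev hx hx1 hx2, height_ev hy hy1 hy2] at this
    exact_mod_cast sub_pos.1 this
  · intro h
    rw [mem_RposD_iff]
    by_cases h' : -y < x
    · exact ⟨x, y, hx, h', h, hy2, rfl⟩
    · refine ⟨-y, -x, by omega, by omega, by omega, by omega, ?_⟩
      rw [ev_neg, ev_neg]; abel

theorem ev_sub_injective {u v u' v' : ℤ} (hu : u ≠ 0) (h1 : -v < u) (h2 : u < v) (h3 : v ≤ n)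
    (hu' : u' ≠ 0) (h1' : -v' < u') (h2' : u' < v') (h3' : v' ≤ n)
    (h : ev n v - ev n u = ev n v' - ev n u') : u = u' ∧ v = v' := by
  have hv : v = v' := by
    have a1 := congrFun h ⟨(v - 1).toNat, by omega⟩
    have a2 := congrFun h ⟨(v' - 1).toNat, by omega⟩
    have b1 : (((v - 1).toNat : ℕ) : ℤ) + 1 = v := by omega
    have b2 : (((v' - 1).toNat : ℕ) : ℤ) + 1 = v' := by omega
    simp only [ev, Pi.sub_apply, b1, b2] at a1 a2
    rcases lt_trichotomy v v' with hlt | heq | hlt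
    · rw [if_neg (by omega), if_neg (by omega), if_neg (by omega), if_neg (by omega),
        if_pos trivial, if_neg (by omega), if_neg (by omega)] at a2
      norm_num at a2
    · exact heq
    · rw [if_pos trivial, if_neg (by omega), if_neg (by omega), if_neg (by omega), if_neg (by omega),
        if_neg (by omega), if_neg (by omega)] at a1
      norm_num at a1
  subst hv
  refine ⟨?_, rfl⟩
  have := congrArg (height n) (sub_right_injective h)
  rw [height_ev hu (by omega) (by omega), height_ev hu' (by omega) (by omega)] at this
  exact_mod_cast this

/-- The `Dₙ`-length of a signed permutation as a number of inversions. -/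
theorem length_eq_card (σ : (Fin n → ℝ) → Fin n → ℝ) (w : ℤ → ℤ) (V : Finset ℤ)
    (hV : V = (Icc (-(n : ℤ)) n).erase 0)
    (hsub : ∀ x y, σ (x - y) = σ x - σ y)
    (hw : ∀ z ∈ V, w z ∈ V ∧ σ (ev n z) = ev n (w z))
    (hodd : ∀ z ∈ V, w (-z) = -w z) (hinj : Set.InjOn w V) :
    Set.ncard {α : Fin n → ℝ | α ∈ RposD n ∧ isNegD n (σ α)} =
      #((V ×ˢ V).filter fun p : ℤ × ℤ => -p.2 < p.1 ∧ p.1 < p.2 ∧ w p.2 < w p.1) := by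
  have hmem : ∀ z, z ∈ V ↔ z ≠ 0 ∧ -(n : ℤ) ≤ z ∧ z ≤ n := fun z => by
    simp only [hV, mem_erase, mem_Icc]
  have hiff : ∀ u ∈ V, ∀ v ∈ V, u ≠ -v → (isNegD n (σ (ev n v - ev n u)) ↔ w v < w u) := by
    intro u hu v hv huv
    obtain ⟨hu1, hu2⟩ := hw u hu
    obtain ⟨hv1, hv2⟩ := hw v hv
    rw [hsub, hu2, hv2]
    have hu3 := (hmem _).1 hu1
    have hv3 := (hmem _).1 hv1
    refine isNegD_ev_sub hv3.1 hv3.2.1 hv3.2.2 hu3.1 hu3.2.1 hu3.2.2 fun h => huv ?_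
    have hnu : -u ∈ V := by
      rw [hmem] at hu ⊢; omega
    rw [← hodd u hu] at h
    rw [hinj hv hnu h, neg_neg]
  rw [← Set.ncard_coe_finset, ← Set.InjOn.ncard_image (f := fun p : ℤ × ℤ => ev n p.2 - ev n p.1)]
  · congr 1
    ext α
    simp only [Set.mem_ofPred_eq, Set.mem_image, mem_coe, mem_filter, mem_product, Prod.exists]
    constructor
    · rintro ⟨h1, h2⟩
      obtain ⟨u, v, hu, h3, h4, h5, rfl⟩ := (mem_RposD_iff α).1 h1
      have huV : u ∈ V := (hmem u).2 (by omega)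
      have hvV : v ∈ V := (hmem v).2 (by omega)
      exact ⟨u, v, ⟨⟨huV, hvV⟩, h3, h4, (hiff u huV v hvV (by omega)).1 h2⟩, rfl⟩
    · rintro ⟨u, v, ⟨⟨hu, hv⟩, h1, h2, h3⟩, rfl⟩
      refine ⟨(mem_RposD_iff _).2 ⟨u, v, ((hmem u).1 hu).1, h1, h2, ((hmem v).1 hv).2.2, rfl⟩,
        (hiff u hu v hv (by omega)).2 h3⟩
  · rintro ⟨u, v⟩ hp ⟨u', v'⟩ hp' h
    simp only [mem_coe, mem_filter, mem_product, hmem] at hp hp'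
    obtain ⟨rfl, rfl⟩ := ev_sub_injective hp.1.1.1 hp.2.1 hp.2.2.1 hp.1.2.2.2
      hp'.1.1.1 hp'.2.1 hp'.2.2.1 hp'.1.2.2.2 h
    rfl

end Roots

section Reflections

variable {n : ℕ}

theorem foldr_comp_ofFn_eq_self {X : Type*} {N : ℕ} (G : Fin N → X → X) (v : X)
    (h : ∀ s, G s v = v) : (List.ofFn G).foldr (· ∘ ·) id v = v := by
  induction N with
  | zero => simp
  | succ N ih =>
    simp only [List.ofFn_succ, List.foldr_cons, Function.comp_apply]
    rw [ih _ fun s => h s.succ, h 0]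

theorem foldr_comp_ofFn_eq {X : Type*} {N : ℕ} (G : Fin N → X → X) (v v' : X) (s₀ : Fin N)
    (h₀ : G s₀ v = v') (h : ∀ s ≠ s₀, G s v = v ∧ G s v' = v') :
    (List.ofFn G).foldr (· ∘ ·) id v = v' := by
  induction N with
  | zero => exact s₀.elim0
  | succ N ih =>
    simp only [List.ofFn_succ, List.foldr_cons, Function.comp_apply]
    cases s₀ using Fin.cases with
    | zero =>
      rw [foldr_comp_ofFn_eq_self _ v fun s => (h s.succ (Fin.succ_ne_zero s)).1, h₀]
    | succ s₁ =>
      rw [ih _ s₁ h₀ fun s hs => h s.succ fun h' => hs (Fin.succ_injective _ h')]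
      exact (h 0 (Fin.succ_ne_zero s₁).symm).2

theorem foldr_comp_append {X : Type*} (l₁ l₂ : List (X → X)) (v : X) :
    (l₁ ++ l₂).foldr (· ∘ ·) id v = l₁.foldr (· ∘ ·) id (l₂.foldr (· ∘ ·) id v) := by
  induction l₁ with
  | nil => rfl
  | cons f l ih => exact congrArg f ih

theorem reflect_sub (α x y : Fin n → ℝ) :
    reflect n α (x - y) = reflect n α x - reflect n α y := by
  have : dot n (x - y) α = dot n x α - dot n y α := by
    simp [dot, sub_mul]
  simp only [reflect, this]
  rw [mul_sub, sub_div, sub_smul]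
  abel

theorem reflect_neg (α x : Fin n → ℝ) : reflect n α (-x) = -reflect n α x := by
  have h := reflect_sub α 0 x
  have h0 := reflect_sub α 0 0
  rw [sub_self, sub_self] at h0
  rwa [h0, zero_sub, zero_sub] at h

theorem foldr_reflect_sub (L : List (Fin n → ℝ)) (x y : Fin n → ℝ) :
    (L.map (reflect n)).foldr (· ∘ ·) id (x - y) =
      (L.map (reflect n)).foldr (· ∘ ·) id x - (L.map (reflect n)).foldr (· ∘ ·) id y := by
  induction L with
  | nil => rfl
  | cons α L ih => simp only [List.map_cons, List.foldr_cons, Function.comp_apply, ih, reflect_sub]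

theorem foldr_reflect_neg (L : List (Fin n → ℝ)) (x : Fin n → ℝ) :
    (L.map (reflect n)).foldr (· ∘ ·) id (-x) = -(L.map (reflect n)).foldr (· ∘ ·) id x := by
  induction L with
  | nil => rfl
  | cons α L ih => simp only [List.map_cons, List.foldr_cons, Function.comp_apply, ih, reflect_neg]

theorem dot_e_left (p : Fin n) (v : Fin n → ℝ) : dot n (e n p) v = v p := by
  simp [dot, e, Pi.single_apply]

theorem dot_sub_left (u v x : Fin n → ℝ) : dot n (u - v) x = dot n u x - dot n v x := by
  simp [dot, sub_mul]

theorem dot_add_left (u v x : Fin n → ℝ) : dot n (u + v) x = dot n u x + dot n v x := by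
  simp [dot, add_mul, sum_add_distrib]

theorem e_apply (p q : Fin n) : e n p q = if q = p then 1 else 0 := by
  simp [e, Pi.single_apply]

theorem reflect_e_sub {p q : Fin n} (h : p ≠ q) (t : Fin n) :
    reflect n (e n q - e n p) (e n t) = if t = p then e n q else if t = q then e n p else e n t := by
  rw [reflect, dot_e_left, dot_sub_left, dot_e_left, dot_e_left]
  split_ifs with h1 h2
  · subst h1; simp [e_apply, h, h.symm]; norm_num
  · subst h2; simp [e_apply, h, h.symm]; norm_num
  · simp [e_apply, h1, h2]

theorem reflect_e_add {p q : Fin n} (h : p ≠ q) (t : Fin n) :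
    reflect n (e n q + e n p) (e n t) =
      if t = p then -e n q else if t = q then -e n p else e n t := by
  rw [reflect, dot_e_left, dot_add_left, dot_e_left, dot_e_left]
  split_ifs with h1 h2
  · subst h1; simp [e_apply, h, h.symm]; norm_num
  · subst h2; simp [e_apply, h, h.symm]; norm_num
  · simp [e_apply, h1, h2]

theorem reflect_e (p t : Fin n) :
    reflect n (e n p) (e n t) = if t = p then -e n p else e n t := by
  rw [reflect, dot_e_left, dot_e_left]
  split_ifs with h1
  · subst h1; simp [e_apply, two_smul]
  · simp [e_apply, h1]

end Reflections

end Stmt2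

open Stmt2 in
/-- Let `S = {e_{jₛ} − e_{iₛ}} ∪ {e_{kₛ}} ∪ {e_{mₛ} + e_{lₛ}}`
(with `a`, `2d` and `f` roots of each kind, in particular an even number of short
roots) be a set of pairwise strongly orthogonal positive roots of type `Bₙ` (all
index sets pairwise disjoint, `iₛ < jₛ`, `lₛ < mₛ`), let `σ` be the product of the
corresponding reflections (an involution lying in `W(Dₙ)`), and let `arcs` be the
associated symmetric link pattern on `{−n, …, −1, 1, …, n}` (a `Fin n`-index `x` is
the vertex `x + 1`).  Then the length of `σ` with respect to the `Dₙ` root system —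
`#{α ∈ R⁺(Dₙ) : σ(α) ∈ R⁻(Dₙ)}` — equals
`|S|² − |S| + a + b(P_S) − c(P_S) − 2·r(P_S)`, where `|S| = arcs.length = 2a+2d+2f`
is the number of arcs. -/
theorem panyushev_length_formula_Dn (n a d f : ℕ) (hn : 2 ≤ n)
    (i j : Fin a → Fin n) (k : Fin (2 * d) → Fin n) (l m : Fin f → Fin n)
    (hij : ∀ s, i s < j s) (hlm : ∀ s, l s < m s)
    (hdisj : (List.ofFn i ++ List.ofFn j ++ List.ofFn k ++
              List.ofFn l ++ List.ofFn m).Nodup)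
    (σ : (Fin n → ℝ) → Fin n → ℝ)
    (hσ : σ = (((List.ofFn fun s => e n (j s) - e n (i s)) ++
                (List.ofFn fun s => e n (k s)) ++
                (List.ofFn fun s => e n (m s) + e n (l s))).map
                  (reflect n)).foldr (· ∘ ·) id)
    (arcs : List (ℤ × ℤ))
    (harcs : arcs =
      (List.ofFn fun s => (((i s : ℕ) : ℤ) + 1, ((j s : ℕ) : ℤ) + 1)) ++
      (List.ofFn fun s => (-(((j s : ℕ) : ℤ) + 1), -(((i s : ℕ) : ℤ) + 1))) ++
      (List.ofFn fun s => (-(((k s : ℕ) : ℤ) + 1), ((k s : ℕ) : ℤ) + 1)) ++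
      (List.ofFn fun s => (-(((m s : ℕ) : ℤ) + 1), ((l s : ℕ) : ℤ) + 1)) ++
      (List.ofFn fun s => (-(((l s : ℕ) : ℤ) + 1), ((m s : ℕ) : ℤ) + 1))) :
    (Set.ncard {α : Fin n → ℝ | α ∈ RposD n ∧ isNegD n (σ α)} : ℤ) =
      (arcs.length : ℤ) ^ 2 - (arcs.length : ℤ) + (a : ℤ) + (bstat n arcs : ℤ)
        - (cstat arcs : ℤ) - 2 * (rstat arcs : ℤ) := by
  have hdisj' := hdisj
  simp only [List.nodup_append, List.nodup_ofFn, List.mem_append, List.mem_ofFn, or_imp,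
    forall_and, forall_exists_index, forall_apply_eq_imp_iff] at hdisj'
  obtain ⟨⟨⟨⟨hi, hj, hij'⟩, hk, hik, hjk⟩, hl, ⟨hil, hjl⟩, hkl⟩, hm, ⟨⟨him, hjm⟩, hkm⟩, hlm'⟩ :=
    hdisj'
  have hσsub : ∀ x y, σ (x - y) = σ x - σ y := fun x y => by
    rw [hσ]; exact foldr_reflect_sub _ x y
  have hσneg : ∀ x, σ (-x) = -σ x := fun x => by
    rw [hσ]; exact foldr_reflect_neg _ x
  have hσcomp : ∀ v, σ v =
      (List.ofFn fun s => reflect n (e n (j s) - e n (i s))).foldr (· ∘ ·) id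
        ((List.ofFn fun s => reflect n (e n (k s))).foldr (· ∘ ·) id
          ((List.ofFn fun s => reflect n (e n (m s) + e n (l s))).foldr (· ∘ ·) id v)) := by
    intro v
    rw [hσ, List.map_append, List.map_append, foldr_comp_append, foldr_comp_append,
      List.map_ofFn, List.map_ofFn, List.map_ofFn]
    rfl
  have hA : ∀ t, (∀ s, t ≠ i s) → (∀ s, t ≠ j s) →
      (List.ofFn fun s => reflect n (e n (j s) - e n (i s))).foldr (· ∘ ·) id (e n t) = e n t :=
    fun t h1 h2 => foldr_comp_ofFn_eq_self _ _ fun s => by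
      rw [reflect_e_sub (hij s).ne, if_neg (h1 s), if_neg (h2 s)]
  have hB : ∀ t, (∀ s, t ≠ k s) →
      (List.ofFn fun s => reflect n (e n (k s))).foldr (· ∘ ·) id (e n t) = e n t :=
    fun t h1 => foldr_comp_ofFn_eq_self _ _ fun s => by rw [reflect_e, if_neg (h1 s)]
  have hC : ∀ t, (∀ s, t ≠ l s) → (∀ s, t ≠ m s) →
      (List.ofFn fun s => reflect n (e n (m s) + e n (l s))).foldr (· ∘ ·) id (e n t) = e n t :=
    fun t h1 h2 => foldr_comp_ofFn_eq_self _ _ fun s => by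
      rw [reflect_e_add (hlm s).ne, if_neg (h1 s), if_neg (h2 s)]
  have hAneg : ∀ v, (List.ofFn fun s => reflect n (e n (j s) - e n (i s))).foldr (· ∘ ·) id (-v) =
      -(List.ofFn fun s => reflect n (e n (j s) - e n (i s))).foldr (· ∘ ·) id v := fun v => by
    have := foldr_reflect_neg (List.ofFn fun s => e n (j s) - e n (i s)) v
    rwa [List.map_ofFn] at this
  have hBneg : ∀ v, (List.ofFn fun s => reflect n (e n (k s))).foldr (· ∘ ·) id (-v) =
      -(List.ofFn fun s => reflect n (e n (k s))).foldr (· ∘ ·) id v := fun v => by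
    have := foldr_reflect_neg (List.ofFn fun s => e n (k s)) v
    rwa [List.map_ofFn] at this
  have hσi : ∀ s, σ (e n (i s)) = e n (j s) := fun s => by
    rw [hσcomp, hC _ (hil s) (him s), hB _ (hik s)]
    refine foldr_comp_ofFn_eq _ _ _ s (by rw [reflect_e_sub (hij s).ne, if_pos rfl]) fun t ht => ?_
    rw [reflect_e_sub (hij t).ne, reflect_e_sub (hij t).ne, if_neg (hi.ne ht.symm),
      if_neg (hij' s t), if_neg (hij' t s).symm, if_neg (hj.ne ht.symm)]
    exact ⟨rfl, rfl⟩
  have hσj : ∀ s, σ (e n (j s)) = e n (i s) := fun s => by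
    rw [hσcomp, hC _ (hjl s) (hjm s), hB _ (hjk s)]
    refine foldr_comp_ofFn_eq _ _ _ s
      (by rw [reflect_e_sub (hij s).ne, if_neg (hij' s s).symm, if_pos rfl]) fun t ht => ?_
    rw [reflect_e_sub (hij t).ne, reflect_e_sub (hij t).ne, if_neg (hi.ne ht.symm),
      if_neg (hij' s t), if_neg (hij' t s).symm, if_neg (hj.ne ht.symm)]
    exact ⟨rfl, rfl⟩
  have hσk : ∀ s, σ (e n (k s)) = -e n (k s) := fun s => by
    rw [hσcomp, hC _ (hkl s) (hkm s),
      foldr_comp_ofFn_eq _ _ (-e n (k s)) s (by rw [reflect_e, if_pos rfl]) fun t ht => ?_,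
      hAneg, hA _ (fun t => (hik t s).symm) (fun t => (hjk t s).symm)]
    rw [reflect_neg, reflect_e, if_neg (hk.ne ht.symm)]
    exact ⟨rfl, rfl⟩
  have hσl : ∀ s, σ (e n (l s)) = -e n (m s) := fun s => by
    rw [hσcomp, foldr_comp_ofFn_eq _ _ (-e n (m s)) s
        (by rw [reflect_e_add (hlm s).ne, if_pos rfl]) fun t ht => ?_,
      hBneg, hB _ (fun t => (hkm t s).symm),
      hAneg, hA _ (fun t => (him t s).symm) (fun t => (hjm t s).symm)]
    rw [reflect_neg, reflect_e_add (hlm t).ne, reflect_e_add (hlm t).ne, if_neg (hl.ne ht.symm),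
      if_neg (hlm' s t), if_neg (hlm' t s).symm, if_neg (hm.ne ht.symm)]
    exact ⟨rfl, rfl⟩
  have hσm : ∀ s, σ (e n (m s)) = -e n (l s) := fun s => by
    rw [hσcomp, foldr_comp_ofFn_eq _ _ (-e n (l s)) s
        (by rw [reflect_e_add (hlm s).ne, if_neg (hlm' s s).symm, if_pos rfl]) fun t ht => ?_,
      hBneg, hB _ (fun t => (hkl t s).symm),
      hAneg, hA _ (fun t => (hil t s).symm) (fun t => (hjl t s).symm)]
    rw [reflect_neg, reflect_e_add (hlm t).ne, reflect_e_add (hlm t).ne, if_neg (hl.ne ht.symm),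
      if_neg (hlm' s t), if_neg (hlm' t s).symm, if_neg (hm.ne ht.symm)]
    exact ⟨rfl, rfl⟩
  have hσfix : ∀ t, (∀ s, t ≠ i s) → (∀ s, t ≠ j s) → (∀ s, t ≠ k s) → (∀ s, t ≠ l s) →
      (∀ s, t ≠ m s) → σ (e n t) = e n t := fun t h1 h2 h3 h4 h5 => by
    rw [hσcomp, hC t h4 h5, hB t h3, hA t h1 h2]
  have hmem : ∀ p ∈ arcs, p.1 < p.2 ∧ -(n : ℤ) ≤ p.1 ∧ p.2 ≤ n ∧ p.1 ≠ 0 ∧ p.2 ≠ 0 ∧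
      σ (ev n p.1) = ev n p.2 ∧ σ (ev n p.2) = ev n p.1 := by
    intro p hp
    simp only [harcs, List.mem_append, List.mem_ofFn] at hp
    rcases hp with (((⟨s, rfl⟩ | ⟨s, rfl⟩) | ⟨s, rfl⟩) | ⟨s, rfl⟩) | ⟨s, rfl⟩
    · have := hij s
      refine ⟨?_, ?_, ?_, ?_, ?_, ?_, ?_⟩
      iterate 5 simp only; omega
      all_goals simp only [ev_succ, hσi, hσj]
    · have := hij s
      refine ⟨?_, ?_, ?_, ?_, ?_, ?_, ?_⟩
      iterate 5 simp only; omega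
      all_goals simp only [ev_neg_succ, hσneg, hσi, hσj]
    · refine ⟨?_, ?_, ?_, ?_, ?_, ?_, ?_⟩
      iterate 5 simp only; omega
      all_goals simp only [ev_succ, ev_neg_succ, hσneg, hσk, neg_neg]
    · refine ⟨?_, ?_, ?_, ?_, ?_, ?_, ?_⟩
      iterate 5 simp only; omega
      all_goals simp only [ev_succ, ev_neg_succ, hσneg, hσl, hσm, neg_neg]
    · refine ⟨?_, ?_, ?_, ?_, ?_, ?_, ?_⟩
      iterate 5 simp only; omega
      all_goals simp only [ev_succ, ev_neg_succ, hσneg, hσl, hσm, neg_neg]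
  have hlen : arcs.length = 2 * a + 2 * d + 2 * f := by
    rw [harcs]; simp only [List.length_append, List.length_ofFn]; omega
  have hsign : arcs.countP (fun p => decide (p.1 < 0 ∧ 0 < p.2)) = 2 * d + 2 * f := by
    simp only [harcs, List.countP_append]
    rw [List.countP_eq_zero.2, List.countP_eq_zero.2, List.countP_eq_length.2,
      List.countP_eq_length.2, List.countP_eq_length.2]
    · simp only [List.length_ofFn]; omega
    all_goals
      simp only [List.forall_mem_ofFn_iff, decide_eq_true_eq]
      intro s
      omega
  have hnodup : (arcs.map fun p => p.1.natAbs).Nodup := by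
    have h : (arcs.map fun p => p.1.natAbs) =
        (List.ofFn i ++ List.ofFn j ++ List.ofFn k ++ List.ofFn m ++ List.ofFn l).map
          fun t : Fin n => (t : ℕ) + 1 := by
      have habs : ∀ t : Fin n, (((t : ℕ) : ℤ) + 1).natAbs = (t : ℕ) + 1 := fun t => by omega
      simp only [harcs, List.map_append, List.map_ofFn, Function.comp_def, Int.natAbs_neg, habs]
    rw [h]
    refine List.Nodup.map (fun u v h => Fin.ext (Nat.succ_injective h)) (List.Perm.nodup ?_ hdisj)
    rw [List.append_assoc _ (List.ofFn l), List.append_assoc _ (List.ofFn m)]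
    exact List.Perm.append_left _ List.perm_append_comm
  set x : Fin arcs.length → ℤ := fun s => (arcs.get s).1 with hx_def
  set y : Fin arcs.length → ℤ := fun s => (arcs.get s).2 with hy_def
  have harc := fun s : Fin arcs.length => hmem _ (arcs.get_mem s)
  have hxinj : Function.Injective x := fun s t hst => by
    rw [List.nodup_iff_injective_get] at hnodup
    have h : (arcs.map fun p => p.1.natAbs).get (s.cast (List.length_map _).symm) =
        (arcs.map fun p => p.1.natAbs).get (t.cast (List.length_map _).symm) := by
      simp only [List.get_eq_getElem, List.getElem_map]
      exact congrArg Int.natAbs hst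
    simpa using hnodup h
  obtain ⟨V, hV⟩ : ∃ V : Finset ℤ, V = (Finset.Icc (-(n : ℤ)) n).erase 0 := ⟨_, rfl⟩
  have hVmem : ∀ z, z ∈ V ↔ z ≠ 0 ∧ -(n : ℤ) ≤ z ∧ z ≤ n := fun z => by
    simp only [hV, Finset.mem_erase, Finset.mem_Icc]
  have hlt : ∀ s, x s < y s := fun s => (harc s).1
  have hxV : ∀ s, x s ∈ V := fun s => by
    obtain ⟨h1, h2, h3, h4, h5, -⟩ := harc s
    exact (hVmem _).2 ⟨h4, h2, h1.le.trans h3⟩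
  have hyV : ∀ s, y s ∈ V := fun s => by
    obtain ⟨h1, h2, h3, h4, h5, -⟩ := harc s
    exact (hVmem _).2 ⟨h5, h2.trans h1.le, h3⟩
  obtain ⟨w, hw⟩ : ∃ w : ℤ → ℤ, w = fun z => ⌊height n (σ (ev n z))⌋ := ⟨_, rfl⟩
  have hwev : ∀ z z', z' ∈ V → σ (ev n z) = ev n z' → w z = z' := fun z z' hz' h => by
    rw [hVmem] at hz'
    rw [hw]
    simp only [h, height_ev hz'.1 hz'.2.1 hz'.2.2, Int.floor_intCast]
  have hwx : ∀ s, w (x s) = y s := fun s => hwev _ _ (hyV s) (harc s).2.2.2.2.2.1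
  have hwy : ∀ s, w (y s) = x s := fun s => hwev _ _ (hxV s) (harc s).2.2.2.2.2.2
  have hxy : ∀ s t, x s ≠ y t := fun s t h => by
    have h1 : y s = x t := by rw [← hwx, h, hwy]
    have := hlt s
    have := hlt t
    omega
  have hyinj : Function.Injective y := fun s t h => hxinj (by rw [← hwy, h, hwy])
  have hσF : ∀ z ∈ V, (∀ t, z ≠ x t ∧ z ≠ y t) → σ (ev n z) = ev n z := by
    intro z hz hzF
    have hzF' : ∀ p ∈ arcs, z ≠ p.1 ∧ z ≠ p.2 := fun p hp => by
      obtain ⟨t, rfl⟩ := List.get_of_mem hp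
      exact hzF t
    simp only [harcs, List.mem_append, or_imp, forall_and, List.mem_ofFn, forall_exists_index,
      forall_apply_eq_imp_iff] at hzF'
    rw [hVmem] at hz
    obtain ⟨t, ht⟩ := exists_fin_succ hz.1 hz.2.1 hz.2.2
    have h : σ (e n t) = e n t := by
      apply hσfix <;> rintro s rfl <;> grind
    rcases ht with rfl | rfl
    · rw [ev_succ, h]
    · rw [ev_neg_succ, hσneg, h]
  have hcases : ∀ z, (∃ s, z = x s) ∨ (∃ s, z = y s) ∨ ∀ t, z ≠ x t ∧ z ≠ y t := fun z => by
    by_cases h1 : ∃ s, z = x s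
    · exact Or.inl h1
    by_cases h2 : ∃ s, z = y s
    · exact Or.inr (Or.inl h2)
    push Not at h1 h2
    exact Or.inr (Or.inr fun t => ⟨h1 t, h2 t⟩)
  have hwV : ∀ z ∈ V, w z ∈ V ∧ σ (ev n z) = ev n (w z) := by
    intro z hz
    rcases hcases z with ⟨s, rfl⟩ | ⟨s, rfl⟩ | h
    · rw [hwx]; exact ⟨hyV s, (harc s).2.2.2.2.2.1⟩
    · rw [hwy]; exact ⟨hxV s, (harc s).2.2.2.2.2.2⟩
    · rw [hwev z z hz (hσF z hz h)]; exact ⟨hz, hσF z hz h⟩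
  have hwF : ∀ u ∈ V, (∀ t, u ≠ x t ∧ u ≠ y t) → w u = u := fun u hu h =>
    hwev u u hu (hσF u hu h)
  have hww : ∀ z ∈ V, w (w z) = z := by
    intro z hz
    rcases hcases z with ⟨s, rfl⟩ | ⟨s, rfl⟩ | h
    · rw [hwx, hwy]
    · rw [hwy, hwx]
    · rw [hwF z hz h, hwF z hz h]
  have hwodd : ∀ z ∈ V, w (-z) = -w z := fun z hz => by
    obtain ⟨h1, h2⟩ := hwV z hz
    refine hwev _ _ ?_ (by rw [ev_neg, hσneg, h2, ev_neg])
    rw [hVmem] at h1 ⊢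
    omega
  have hlength := length_eq_card σ w V hV hσsub hwV hwodd
    (Set.LeftInvOn.injOn (f₁' := w) fun z hz => hww z hz)
  have hinv := invCount_odd n w V hV hwodd
  have hinv' := invCount_add x y V w hlt hxinj hyinj hxy hxV hyV hwx hwy hwF
  have hneg : (V.filter fun v => v < 0 ∧ 0 < w v).card = 2 * d + 2 * f := by
    have h : (V.filter fun v => v < 0 ∧ 0 < w v) =
        (Finset.univ.filter fun s => x s < 0 ∧ 0 < y s).image x := by
      ext z
      simp only [Finset.mem_filter, Finset.mem_image, Finset.mem_univ, true_and]
      constructor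
      · rintro ⟨hz, h1, h2⟩
        rcases hcases z with ⟨s, rfl⟩ | ⟨s, rfl⟩ | h
        · exact ⟨s, ⟨h1, hwx s ▸ h2⟩, rfl⟩
        · have := hlt s
          rw [hwy] at h2
          omega
        · rw [hwF z hz h] at h2
          omega
      · rintro ⟨s, h, rfl⟩
        rw [hwx]
        exact ⟨hxV s, h⟩
    rw [h, Finset.card_image_of_injective _ hxinj, ← hsign]
    exact card_filter_get arcs fun p => p.1 < 0 ∧ 0 < p.2
  have hc : cstat arcs = ∑ s, ∑ t, if x t < x s ∧ x s < y t ∧ y t < y s then 1 else 0 := by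
    rw [← ncard_setOf_prod Finset.univ]
    simp only [Finset.mem_univ, true_and]
    rfl
  have hr : rstat arcs = ∑ s, ∑ t, if y s < x t then 1 else 0 := by
    rw [← ncard_setOf_prod Finset.univ]
    simp only [Finset.mem_univ, true_and]
    rfl
  have hb : bstat n arcs = ∑ s, ∑ v ∈ V.filter (fun u => ∀ t, u ≠ x t ∧ u ≠ y t),
      if x s < v ∧ v < y s then 1 else 0 := by
    rw [← ncard_setOf_prod, bstat]
    congr 1
    ext ⟨s, v⟩
    simp only [Set.mem_ofPred_eq, Finset.mem_filter, hVmem, hx_def, hy_def]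
    tauto
  rw [hlength, hc, hr, hb]
  rw [hneg] at hinv
  have hlen' : (arcs.length : ℤ) = 2 * a + 2 * d + 2 * f := by exact_mod_cast hlen
  zify at hinv hinv'
  push_cast at hinv hinv' ⊢
  linarith
end
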